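/- arXiv:1011.2656 — 12 statements merged into one kernel-verified Lean document; each statement's English description precedes it below -/
import Mathlib

section
/- Let K be a field, let d ≥ 1 and μ be natural numbers, and let t ≤ u be integers. For 0 ≤ j ≤ d let a_j(ε,N) ∈ K[ε,N] be polynomials such that a_d(0,k) ≠ 0 for all integers k ≥ μ, and write a_{j,m}(N) ∈ K for the coefficient of ε^m in a_j(ε,N) (viewed as a polynomial in ε with coefficients in K[N], evaluated at N). Given functions h_t,…,h_u : ℕ → K and constants c_{i,k} ∈ K for t ≤ i ≤ u and μ ≤ k < μ+d, there exist functions F_t,…,F_u : ℕ → K such that (i) F_i(k) = c_{i,k} for all t ≤ i ≤ u and μ ≤ k < μ+d, and (ii) for all integers N ≥ μ and all r with t ≤ r ≤ u one has Σ_{j=0}^{d} Σ_{l=t}^{r} a_{j,r−l}(N)·F_l(N+j) = h_r(N). Moreover these functions are unique on the domain {k ∈ ℕ : k ≥ μ}: any two tuples (F_t,…,F_u) and (G_t,…,G_u) satisfying (i) and (ii) agree at every argument k ≥ μ. -/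
namespace TruncatedRecurrence

variable {K : Type*} [Field K]

/-- The coefficient of order `r` of a truncated recurrence at `N`, with the leading unknown
`F r (N + d)` split off. -/
theorem sum_eq_add_leading (b : ℕ → ℕ → ℕ → K) (d : ℕ) {t r : ℤ} (htr : t ≤ r)
    (F : ℤ → ℕ → K) (N : ℕ) :
    ∑ j ∈ Finset.range (d + 1), ∑ l ∈ Finset.Icc t r, b j (r - l).toNat N * F l (N + j) =
      ∑ j ∈ Finset.range d, ∑ l ∈ Finset.Icc t r, b j (r - l).toNat N * F l (N + j) +
        ∑ l ∈ Finset.Ico t r, b d (r - l).toNat N * F l (N + d) + b d 0 N * F r (N + d) := by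
  rw [Finset.sum_range_succ, ← Finset.Ico_insert_right htr,
    Finset.sum_insert Finset.right_notMem_Ico]
  simp only [sub_self, Int.toNat_zero]
  ring

/-- The solution with initial values `c`, obtained by solving for the leading unknown, by
recursion on the argument and then on the order. -/
noncomputable def solution (b : ℕ → ℕ → ℕ → K) (d μ : ℕ) (t : ℤ) (h c : ℤ → ℕ → K) (i : ℤ) (k : ℕ) : K :=
  if hk : k < μ + d then c i k
  else (b d 0 (k - d))⁻¹ * (h i (k - d) -
    (∑ j : Finset.range d, ∑ l : Finset.Icc t i,
        b j (i - l).toNat (k - d) * solution b d μ t h c l (k - d + j) +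
      ∑ l : Finset.Ico t i, b d (i - l).toNat (k - d) * solution b d μ t h c l k))
termination_by (k, (i - t).toNat)
decreasing_by
  · have := Finset.mem_range.mp j.2
    exact Prod.Lex.left _ _ (by omega)
  · have := Finset.mem_Ico.mp l.2
    exact Prod.Lex.right _ (by omega)

theorem solution_of_lt (b : ℕ → ℕ → ℕ → K) {d μ : ℕ} (t : ℤ) (h c : ℤ → ℕ → K) (i : ℤ) {k : ℕ}
    (hk : k < μ + d) : solution b d μ t h c i k = c i k := by
  rw [solution, dif_pos hk]

theorem solution_add (b : ℕ → ℕ → ℕ → K) (d : ℕ) {μ : ℕ} (t : ℤ) (h c : ℤ → ℕ → K) (i : ℤ)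
    {N : ℕ} (hN : μ ≤ N) :
    solution b d μ t h c i (N + d) = (b d 0 N)⁻¹ * (h i N -
      (∑ j ∈ Finset.range d, ∑ l ∈ Finset.Icc t i,
          b j (i - l).toNat N * solution b d μ t h c l (N + j) +
        ∑ l ∈ Finset.Ico t i, b d (i - l).toNat N * solution b d μ t h c l (N + d))) := by
  rw [solution, dif_neg (by omega), Nat.add_sub_cancel]
  congr 3
  · rw [← Finset.sum_coe_sort (Finset.range d)]
    refine Finset.sum_congr rfl fun j _ => ?_
    exact Finset.sum_coe_sort (Finset.Icc t i)
      fun l => b j (i - l).toNat N * solution b d μ t h c l (N + j)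
  · exact Finset.sum_coe_sort (Finset.Ico t i)
      fun l => b d (i - l).toNat N * solution b d μ t h c l (N + d)

theorem solution_recurrence (b : ℕ → ℕ → ℕ → K) (d : ℕ) {μ : ℕ} {t r : ℤ} (h c : ℤ → ℕ → K)
    (htr : t ≤ r) {N : ℕ} (hN : μ ≤ N) (hb : b d 0 N ≠ 0) :
    ∑ j ∈ Finset.range (d + 1), ∑ l ∈ Finset.Icc t r,
      b j (r - l).toNat N * solution b d μ t h c l (N + j) = h r N := by
  rw [sum_eq_add_leading b d htr, solution_add b d t h c r hN, mul_inv_cancel_left₀ hb]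
  ring

/-- Two solutions of the same truncated recurrence with the same initial values agree. -/
theorem eq_of_recurrence {b : ℕ → ℕ → ℕ → K} {d μ : ℕ} {t u : ℤ} {F G : ℤ → ℕ → K}
    (hb : ∀ N, μ ≤ N → b d 0 N ≠ 0)
    (init : ∀ i, t ≤ i → i ≤ u → ∀ k, μ ≤ k → k < μ + d → F i k = G i k)
    (rec : ∀ N, μ ≤ N → ∀ r, t ≤ r → r ≤ u →
      ∑ j ∈ Finset.range (d + 1), ∑ l ∈ Finset.Icc t r, b j (r - l).toNat N * F l (N + j) =
      ∑ j ∈ Finset.range (d + 1), ∑ l ∈ Finset.Icc t r, b j (r - l).toNat N * G l (N + j))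
    (i : ℤ) (hti : t ≤ i) (hiu : i ≤ u) (k : ℕ) (hk : μ ≤ k) : F i k = G i k := by
  by_cases hkd : k < μ + d
  · exact init i hti hiu k hk hkd
  obtain ⟨N, hNk⟩ : ∃ N, N + d = k := ⟨k - d, by omega⟩
  have hN : μ ≤ N := by omega
  have lower : ∑ j ∈ Finset.range d, ∑ l ∈ Finset.Icc t i, b j (i - l).toNat N * F l (N + j) =
      ∑ j ∈ Finset.range d, ∑ l ∈ Finset.Icc t i, b j (i - l).toNat N * G l (N + j) := by
    refine Finset.sum_congr rfl fun j hj => Finset.sum_congr rfl fun l hl => ?_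
    have hjd := Finset.mem_range.mp hj
    have htl := Finset.mem_Icc.mp hl
    rw [eq_of_recurrence hb init rec l htl.1 (htl.2.trans hiu) (N + j) (by omega)]
  have top : ∑ l ∈ Finset.Ico t i, b d (i - l).toNat N * F l k =
      ∑ l ∈ Finset.Ico t i, b d (i - l).toNat N * G l k := by
    refine Finset.sum_congr rfl fun l hl => ?_
    have htl := Finset.mem_Ico.mp hl
    rw [eq_of_recurrence hb init rec l htl.1 (htl.2.le.trans hiu) k hk]
  have heq := rec N hN i hti hiu
  rw [sum_eq_add_leading b d hti, sum_eq_add_leading b d hti, hNk, lower, top] at heq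
  exact mul_left_cancel₀ (hb N hN) (add_left_cancel heq)
termination_by (k, (i - t).toNat)
decreasing_by
  · exact Prod.Lex.left _ _ (by omega)
  · exact Prod.Lex.right _ (by omega)

end TruncatedRecurrence

/-- Lemma 1 of the paper (coefficientwise form): existence and uniqueness of the
coefficient functions `F_t, …, F_u` of a truncated formal Laurent series solution
of a linear recurrence with polynomial coefficients, given initial values. -/
theorem stmt_0 (K : Type*) [Field K] (d μ : ℕ) (hd : 1 ≤ d) (t u : ℤ) (htu : t ≤ u)
    (a : ℕ → Polynomial (Polynomial K))
    (had : ∀ k : ℕ, μ ≤ k → ((a d).coeff 0).eval (k : K) ≠ 0)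
    (h : ℤ → ℕ → K) (c : ℤ → ℕ → K) :
    (∃ F : ℤ → ℕ → K,
      (∀ i : ℤ, t ≤ i → i ≤ u → ∀ k : ℕ, μ ≤ k → k < μ + d → F i k = c i k) ∧
      (∀ N : ℕ, μ ≤ N → ∀ r : ℤ, t ≤ r → r ≤ u →
        ∑ j ∈ Finset.range (d + 1), ∑ l ∈ Finset.Icc t r,
          ((a j).coeff (r - l).toNat).eval (N : K) * F l (N + j) = h r N)) ∧
    (∀ F G : ℤ → ℕ → K,
      ((∀ i : ℤ, t ≤ i → i ≤ u → ∀ k : ℕ, μ ≤ k → k < μ + d → F i k = c i k) ∧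
       (∀ N : ℕ, μ ≤ N → ∀ r : ℤ, t ≤ r → r ≤ u →
         ∑ j ∈ Finset.range (d + 1), ∑ l ∈ Finset.Icc t r,
           ((a j).coeff (r - l).toNat).eval (N : K) * F l (N + j) = h r N)) →
      ((∀ i : ℤ, t ≤ i → i ≤ u → ∀ k : ℕ, μ ≤ k → k < μ + d → G i k = c i k) ∧
       (∀ N : ℕ, μ ≤ N → ∀ r : ℤ, t ≤ r → r ≤ u →
         ∑ j ∈ Finset.range (d + 1), ∑ l ∈ Finset.Icc t r,
           ((a j).coeff (r - l).toNat).eval (N : K) * G l (N + j) = h r N)) →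
      ∀ i : ℤ, t ≤ i → i ≤ u → ∀ k : ℕ, μ ≤ k → F i k = G i k) := by
  let b : ℕ → ℕ → ℕ → K := fun j m N => ((a j).coeff m).eval (N : K)
  refine ⟨⟨TruncatedRecurrence.solution b d μ t h c, fun i _ _ k _ hk =>
    TruncatedRecurrence.solution_of_lt b t h c i hk, fun N hN r htr _ =>
    TruncatedRecurrence.solution_recurrence b d h c htr hN (had N hN)⟩, ?_⟩
  rintro F G ⟨hF, hF'⟩ ⟨hG, hG'⟩
  exact TruncatedRecurrence.eq_of_recurrence (b := b) had
    (fun i hti hiu k hk hkd => (hF i hti hiu k hk hkd).trans (hG i hti hiu k hk hkd).symm)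
    (fun N hN r htr hru => (hF' N hN r htr hru).trans (hG' N hN r htr hru).symm)
end

section
/- Let K be a field, let d ≥ 1 and λ ≥ 1 be integers, and let b_1,…,b_d : ℕ → K satisfy b_i(j) ≠ 0 for all j ≥ λ−1. For 1 ≤ i ≤ d define the hypergeometric term h_i(N) = ∏_{j=λ}^{N} b_i(j−1) (so h_i(λ−1) = 1). For 1 ≤ m ≤ d define nested sequences by K^{(m)}_m = h_m and, for 1 ≤ k < m, K^{(m)}_k(N) = h_k(N)·Σ_{i=λ}^{N−1} K^{(m)}_{k+1}(i)/h_k(i+1), and set H_m := K^{(m)}_1. Then the restrictions of H_1,…,H_d to the set {N ∈ ℕ : N ≥ λ−1} are linearly independent over K: if c_1,…,c_d ∈ K satisfy c_1 H_1(N) + ⋯ + c_d H_d(N) = 0 for all integers N ≥ λ−1, then c_1 = ⋯ = c_d = 0. -/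
/-- The hypergeometric term `h_i(N) = ∏_{j=λ}^{N} b_i(j-1)`. -/
noncomputable def hterm (K : Type*) [Field K] (b : ℕ → ℕ → K) (lam i N : ℕ) : K :=
  ∏ j ∈ Finset.Icc lam N, b i (j - 1)

/-- The nested sequences `K^{(m)}_k` (indexed here by `j = m - k`):
`nestK … m 0 = h_m` and
`nestK … m (j+1) N = h_{m-j-1}(N) · ∑_{i=λ}^{N-1} nestK … m j i / h_{m-j-1}(i+1)`. -/
noncomputable def nestK (K : Type*) [Field K] (b : ℕ → ℕ → K) (lam m : ℕ) : ℕ → ℕ → K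
  | 0 => hterm K b lam m
  | j + 1 => fun N =>
      hterm K b lam (m - j - 1) N *
        ∑ i ∈ Finset.Ico lam N, nestK K b lam m j i / hterm K b lam (m - j - 1) (i + 1)

/-- The nested-sum solution `H_m = K^{(m)}_1`. -/
noncomputable def Hsol (K : Type*) [Field K] (b : ℕ → ℕ → K) (lam m : ℕ) : ℕ → K :=
  nestK K b lam m (m - 1)

theorem hterm_ne_zero {K : Type*} [Field K] {b : ℕ → ℕ → K} {lam i : ℕ}
    (hb : ∀ j : ℕ, lam - 1 ≤ j → b i j ≠ 0) (N : ℕ) : hterm K b lam i N ≠ 0 :=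
  Finset.prod_ne_zero_iff.2 fun _ hj => hb _ (Nat.sub_le_sub_right (Finset.mem_Icc.1 hj).1 1)

theorem nestK_succ {K : Type*} [Field K] (b : ℕ → ℕ → K) (lam m j N : ℕ) :
    nestK K b lam m (j + 1) N = hterm K b lam (m - j - 1) N *
      ∑ i ∈ Finset.Ico lam N, nestK K b lam m j i / hterm K b lam (m - j - 1) (i + 1) :=
  rfl

theorem nestK_succ_eq_zero {K : Type*} [Field K] (b : ℕ → ℕ → K) (lam m j : ℕ) :
    ∀ N : ℕ, N ≤ lam + j → nestK K b lam m (j + 1) N = 0 := by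
  induction j with
  | zero =>
    intro N hN
    rw [nestK_succ, Finset.Ico_eq_empty_of_le (a := lam) hN, Finset.sum_empty, mul_zero]
  | succ j ih =>
    intro N hN
    rw [nestK_succ, Finset.sum_eq_zero, mul_zero]
    intro i hi
    rw [ih i (by have := (Finset.mem_Ico.1 hi).2; omega), zero_div]

theorem nestK_ne_zero {K : Type*} [Field K] {b : ℕ → ℕ → K} {lam m : ℕ}
    (hb : ∀ i : ℕ, 1 ≤ i → i ≤ m → ∀ j : ℕ, lam - 1 ≤ j → b i j ≠ 0) (j : ℕ) (hj : j < m) :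
    nestK K b lam m j (lam + j) ≠ 0 := by
  induction j with
  | zero => exact hterm_ne_zero (hb m (by omega) le_rfl) _
  | succ j ih =>
    have hh := hterm_ne_zero (hb (m - j - 1) (by omega) (by omega))
    rw [nestK_succ, Finset.sum_eq_single (lam + j)]
    · exact mul_ne_zero (hh _) (div_ne_zero (ih (by omega)) (hh _))
    · intro i hi hne
      have hi := Finset.mem_Ico.1 hi
      obtain ⟨k, rfl⟩ : ∃ k, j = k + 1 := Nat.exists_eq_succ_of_ne_zero (by omega)
      rw [nestK_succ_eq_zero b lam m k i (by omega), zero_div]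
    · intro h
      exact absurd (Finset.mem_Ico.2 ⟨by omega, by omega⟩) h

/-- The restrictions of the nested-sum solutions `H_1, …, H_d` to `{N : N ≥ λ-1}` are
linearly independent over `K`. -/
theorem stmt_4 (K : Type*) [Field K] (d lam : ℕ) (hd : 1 ≤ d) (hlam : 1 ≤ lam)
    (b : ℕ → ℕ → K)
    (hb : ∀ i : ℕ, 1 ≤ i → i ≤ d → ∀ j : ℕ, lam - 1 ≤ j → b i j ≠ 0)
    (c : ℕ → K)
    (hc : ∀ N : ℕ, lam - 1 ≤ N → ∑ m ∈ Finset.Icc 1 d, c m * Hsol K b lam m N = 0) :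
    ∀ m : ℕ, 1 ≤ m → m ≤ d → c m = 0 := by
  intro m
  induction m using Nat.strong_induction_on with
  | _ m ih =>
    intro hm hmd
    have h := hc (lam + (m - 1)) (by omega)
    rw [Finset.sum_eq_single_of_mem m (Finset.mem_Icc.2 ⟨hm, hmd⟩)] at h
    · exact (mul_eq_zero.1 h).resolve_right
        (nestK_ne_zero (fun i hi him => hb i hi (him.trans hmd)) (m - 1) (by omega))
    · intro n hn hne
      have hn := Finset.mem_Icc.1 hn
      rcases lt_or_gt_of_ne hne with hlt | hgt
      · rw [ih n hlt hn.1 hn.2, zero_mul]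
      · obtain ⟨k, rfl⟩ : ∃ k, n = k + 2 := ⟨n - 2, by omega⟩
        rw [Hsol, show k + 2 - 1 = k + 1 from rfl,
          nestK_succ_eq_zero b lam (k + 2) k _ (by omega), mul_zero]
end

section
/- For ε ∈ ℝ and an integer N ≥ 1 define S(ε,N) = Σ_{k=0}^{N−1} (−2)^k (k+2) Γ(4−ε) Γ(ε/2+3) Γ(N) Γ(k+2−ε/2) / (Γ(2−ε/2) Γ(k+4−ε) Γ(k+3+ε/2) Γ(N−k)), where Γ denotes the real Gamma function. Then for all real ε with |ε| < 2 and all integers N ≥ 1: 2N(N+1)(ε+2N+5)·S(ε,N) + (N+1)(ε²+2εN+5ε+4N+12)·S(ε,N+1) + (ε−N−4)(ε+2N+3)(ε+2N+6)·S(ε,N+2) = −24N − 48 + (2N−20)ε + (2N+6)ε² + 2ε³. -/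
/-- The hypergeometric single sum (Equ:SimpleSumProblem) of the paper. -/
noncomputable def S8 (ε : ℝ) (N : ℕ) : ℝ :=
  ∑ k ∈ Finset.range N,
    (-2 : ℝ) ^ k * ((k : ℝ) + 2) * Real.Gamma (4 - ε) * Real.Gamma (ε / 2 + 3) *
        Real.Gamma (N : ℝ) * Real.Gamma ((k : ℝ) + 2 - ε / 2) /
      (Real.Gamma (2 - ε / 2) * Real.Gamma ((k : ℝ) + 4 - ε) *
        Real.Gamma ((k : ℝ) + 3 + ε / 2) * Real.Gamma ((N : ℝ) - (k : ℝ)))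

open Real in
/-- The part of the summand of `S8` that depends neither on `N` nor on the factor `k + 2`. -/
noncomputable def gammaRatio (ε : ℝ) (k : ℕ) : ℝ :=
  (-2 : ℝ) ^ k * Gamma (4 - ε) * Gamma (ε / 2 + 3) * Gamma ((k : ℝ) + 2 - ε / 2) /
    (Gamma (2 - ε / 2) * Gamma ((k : ℝ) + 4 - ε) * Gamma ((k : ℝ) + 3 + ε / 2))

theorem gammaRatio_zero {ε : ℝ} (hε : |ε| < 2) : gammaRatio ε 0 = 1 := by
  obtain ⟨h₁, h₂⟩ := abs_lt.mp hε
  have hA : Real.Gamma (4 - ε) ≠ 0 := (Real.Gamma_pos_of_pos (by linarith)).ne'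
  have hB : Real.Gamma (3 + ε / 2) ≠ 0 := (Real.Gamma_pos_of_pos (by linarith)).ne'
  have hC : Real.Gamma (2 - ε / 2) ≠ 0 := (Real.Gamma_pos_of_pos (by linarith)).ne'
  simp only [gammaRatio, Nat.cast_zero, zero_add, pow_zero, one_mul, add_comm (ε / 2) 3]
  rw [div_eq_one_iff_eq (mul_ne_zero (mul_ne_zero hC hA) hB)]
  ring

theorem gammaRatio_succ {ε : ℝ} (hε : |ε| < 2) (k : ℕ) :
    gammaRatio ε (k + 1) * (((k : ℝ) + 4 - ε) * ((k : ℝ) + 3 + ε / 2)) =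
      -2 * ((k : ℝ) + 2 - ε / 2) * gammaRatio ε k := by
  obtain ⟨h₁, h₂⟩ := abs_lt.mp hε
  have hk : (0 : ℝ) ≤ k := k.cast_nonneg
  have ha : (0 : ℝ) < k + 4 - ε := by linarith
  have hb : (0 : ℝ) < k + 3 + ε / 2 := by linarith
  have hc : (0 : ℝ) < k + 2 - ε / 2 := by linarith
  have hA := (Real.Gamma_pos_of_pos ha).ne'
  have hB := (Real.Gamma_pos_of_pos hb).ne'
  have hC : Real.Gamma (2 - ε / 2) ≠ 0 := (Real.Gamma_pos_of_pos (by linarith)).ne'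
  have eA : ((k + 1 : ℕ) : ℝ) + 4 - ε = (k + 4 - ε) + 1 := by push_cast; ring
  have eB : ((k + 1 : ℕ) : ℝ) + 3 + ε / 2 = (k + 3 + ε / 2) + 1 := by push_cast; ring
  have eC : ((k + 1 : ℕ) : ℝ) + 2 - ε / 2 = (k + 2 - ε / 2) + 1 := by push_cast; ring
  rw [gammaRatio, gammaRatio, eA, eB, eC, Real.Gamma_add_one ha.ne', Real.Gamma_add_one hb.ne',
    Real.Gamma_add_one hc.ne']
  generalize Real.Gamma ((k : ℝ) + 4 - ε) = A at *
  generalize Real.Gamma ((k : ℝ) + 3 + ε / 2) = B at *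
  generalize Real.Gamma ((k : ℝ) + 2 - ε / 2) = C at *
  generalize (k : ℝ) + 4 - ε = a at *
  generalize (k : ℝ) + 3 + ε / 2 = b at *
  generalize (k : ℝ) + 2 - ε / 2 = c at *
  have ha' := ha.ne'
  have hb' := hb.ne'
  rw [pow_succ]
  field_simp

theorem cast_descFactorial_succ (n k : ℕ) :
    (n.descFactorial (k + 1) : ℝ) = ((n : ℝ) - k) * n.descFactorial k := by
  rcases le_or_gt k n with h | h
  · rw [Nat.descFactorial_succ, Nat.cast_mul, Nat.cast_sub h]
  · simp [Nat.descFactorial_of_lt h]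

theorem succ_mul_cast_descFactorial (n k : ℕ) :
    ((n : ℝ) + 1) * n.descFactorial k = ((n : ℝ) + 1 - k) * (n + 1).descFactorial k := by
  have h : ((n + 1).descFactorial (k + 1) : ℝ) = ((n : ℝ) + 1) * n.descFactorial k := by
    rw [Nat.succ_descFactorial_succ]
    push_cast
    ring
  rw [← h, cast_descFactorial_succ]
  push_cast
  ring

theorem Gamma_div_Gamma_sub_eq_descFactorial {n k : ℕ} (hk : k ≤ n) :
    Real.Gamma ((n : ℝ) + 1) / Real.Gamma ((n : ℝ) + 1 - k) = n.descFactorial k := by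
  have e : (n : ℝ) + 1 - k = ((n - k : ℕ) : ℝ) + 1 := by
    rw [Nat.cast_sub hk]
    ring
  rw [e, Real.Gamma_nat_eq_factorial, Real.Gamma_nat_eq_factorial,
    ← Nat.factorial_mul_descFactorial hk, Nat.cast_mul,
    mul_div_cancel_left₀ _ (Nat.cast_ne_zero.mpr (n - k).factorial_ne_zero)]

/-- The sum `S8 ε (n + 1)` may be extended over any larger range, since the falling factorials
vanish there. -/
theorem S8_succ_eq_sum (ε : ℝ) {n m : ℕ} (hm : n + 1 ≤ m) :
    S8 ε (n + 1) =
      ∑ k ∈ Finset.range m, ((k : ℝ) + 2) * gammaRatio ε k * n.descFactorial k := by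
  rw [← Finset.sum_subset (Finset.range_subset_range.mpr hm)]
  · refine Finset.sum_congr rfl fun k hk => ?_
    rw [← Gamma_div_Gamma_sub_eq_descFactorial (Nat.lt_succ_iff.mp (Finset.mem_range.mp hk)),
      gammaRatio, Nat.cast_add_one]
    simp only [div_eq_mul_inv, mul_inv]
    ring
  · intro k _ hk
    have hnk : n < k := not_lt.mp (mt Finset.mem_range.mpr hk)
    simp [Nat.descFactorial_of_lt hnk]

/-- The antidifference in `k` certifying the recurrence for `S8 ε (n + 1)`. -/
noncomputable def telescoper (ε : ℝ) (n k : ℕ) : ℝ :=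
  ((k : ℝ) + 3 - ε) * ((k : ℝ) + 2 + ε / 2) *
    (2 * (ε + 2 * n + 7) * k + 4 * (n + 3 + ε)) * gammaRatio ε k * (n + 2).descFactorial k

theorem telescoper_succ_sub {ε : ℝ} (hε : |ε| < 2) (n k : ℕ) :
    telescoper ε n (k + 1) - telescoper ε n k =
      2 * ((n : ℝ) + 1) * (n + 2) * (ε + 2 * n + 7) *
          (((k : ℝ) + 2) * gammaRatio ε k * n.descFactorial k) +
        ((n : ℝ) + 2) * (ε ^ 2 + 2 * ε * (n + 1) + 5 * ε + 4 * (n + 1) + 12) *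
          (((k : ℝ) + 2) * gammaRatio ε k * (n + 1).descFactorial k) +
        (ε - n - 5) * (ε + 2 * n + 5) * (ε + 2 * n + 8) *
          (((k : ℝ) + 2) * gammaRatio ε k * (n + 2).descFactorial k) := by
  have h₁ := succ_mul_cast_descFactorial n k
  have h₂ := succ_mul_cast_descFactorial (n + 1) k
  have h₃ := cast_descFactorial_succ (n + 2) k
  have h₄ := gammaRatio_succ hε k
  simp only [telescoper]
  rw [h₃]
  push_cast at *
  simp only [add_assoc, one_add_one_eq_two] at h₂
  generalize (n.descFactorial k : ℝ) = D₀ at *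
  generalize ((n + 1).descFactorial k : ℝ) = D₁ at *
  generalize ((n + 2).descFactorial k : ℝ) = D₂ at *
  generalize gammaRatio ε (k + 1) = b' at *
  generalize gammaRatio ε k = b at *
  generalize (n : ℝ) = n at *
  generalize (k : ℝ) = k at *
  linear_combination (2 * (ε + 2 * n + 7) * (k + 1) + 4 * (n + 3 + ε)) * (n + 2 - k) * D₂ * h₄ -
    2 * (n + 2) * (ε + 2 * n + 7) * (k + 2) * b * h₁ -
    (2 * (n + 1 - k) * (ε + 2 * n + 7) +
      (ε ^ 2 + 2 * ε * (n + 1) + 5 * ε + 4 * (n + 1) + 12)) * (k + 2) * b * h₂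

/-- The inhomogeneous linear recurrence (Equ:SingleSumRec) with coefficients
(Equ:SingleSumRecCoef) for the sum (Equ:SimpleSumProblem). -/
theorem stmt_8 :
    ∀ ε : ℝ, |ε| < 2 → ∀ N : ℕ, 1 ≤ N →
      2 * (N : ℝ) * ((N : ℝ) + 1) * (ε + 2 * (N : ℝ) + 5) * S8 ε N +
          ((N : ℝ) + 1) * (ε ^ 2 + 2 * ε * (N : ℝ) + 5 * ε + 4 * (N : ℝ) + 12) *
            S8 ε (N + 1) +
          (ε - (N : ℝ) - 4) * (ε + 2 * (N : ℝ) + 3) * (ε + 2 * (N : ℝ) + 6) *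
            S8 ε (N + 2) =
        -24 * (N : ℝ) - 48 + (2 * (N : ℝ) - 20) * ε + (2 * (N : ℝ) + 6) * ε ^ 2 +
          2 * ε ^ 3 := by
  intro ε hε N hN
  obtain ⟨n, rfl⟩ := Nat.exists_eq_add_of_le' hN
  have hsum := Finset.sum_range_sub (telescoper ε n) (n + 3)
  have hend : telescoper ε n (n + 3) = 0 := by
    simp [telescoper]
  have hstart : telescoper ε n 0 = (3 - ε) * (2 + ε / 2) * (4 * (n + 3 + ε)) := by
    simp [telescoper, gammaRatio_zero hε]
  simp only [telescoper_succ_sub hε, Finset.sum_add_distrib, ← Finset.mul_sum] at hsum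
  rw [hend, hstart, ← S8_succ_eq_sum ε (show n + 1 ≤ n + 3 by lia),
    ← S8_succ_eq_sum ε (show n + 1 + 1 ≤ n + 3 by lia),
    ← S8_succ_eq_sum ε (show n + 2 + 1 ≤ n + 3 by lia)] at hsum
  push_cast
  linear_combination hsum
end

section
/- For every integer N ≥ 1 the following identity holds in ℚ: Σ_{k=0}^{N−1} 12·(−2)^k·(k+2)·(N−1)!·(k+1)! / ((k+3)!·(k+2)!·(N−1−k)!) = 3(2N²+4N+1)/(2N(N+1)(N+2)) − 3(−1)^N/(2N(N+1)(N+2)). -/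
/-- The binomial expansion of `(-2 + 1) ^ (n + 3)` with its first three terms split off. -/
theorem sum_neg_two_pow_mul_choose_add_three (n : ℕ) :
    ∑ k ∈ Finset.range (n + 1), (-2 : ℚ) ^ (k + 3) * ((n + 3).choose (k + 3) : ℚ) =
      (-1) ^ (n + 3) - 1 + 2 * ((n : ℚ) + 3) - 2 * ((n : ℚ) + 3) * ((n : ℚ) + 2) := by
  have h := add_pow (-2 : ℚ) 1 (n + 3)
  rw [Finset.sum_range_succ', Finset.sum_range_succ', Finset.sum_range_succ'] at h
  norm_num [Nat.cast_choose_two] at h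
  linear_combination -h

/-- (Equ:SingleSumF0): closed form for the constant term `F_0(N)` of the ε-expansion of
the single sum (Equ:SimpleSumProblem). -/
theorem stmt_9 (N : ℕ) (hN : 1 ≤ N) :
    ∑ k ∈ Finset.range N,
        12 * (-2 : ℚ) ^ k * ((k : ℚ) + 2) * ((N - 1).factorial : ℚ) *
            ((k + 1).factorial : ℚ) /
          (((k + 3).factorial : ℚ) * ((k + 2).factorial : ℚ) *
            ((N - 1 - k).factorial : ℚ)) =
      3 * (2 * (N : ℚ) ^ 2 + 4 * (N : ℚ) + 1) / (2 * (N : ℚ) * ((N : ℚ) + 1) * ((N : ℚ) + 2)) -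
        3 * (-1 : ℚ) ^ N / (2 * (N : ℚ) * ((N : ℚ) + 1) * ((N : ℚ) + 2)) := by
  obtain ⟨n, rfl⟩ := Nat.exists_eq_add_of_le' hN
  have hterm : ∀ k ∈ Finset.range (n + 1),
      12 * (-2 : ℚ) ^ k * ((k : ℚ) + 2) * ((n + 1 - 1).factorial : ℚ) * ((k + 1).factorial : ℚ) /
          (((k + 3).factorial : ℚ) * ((k + 2).factorial : ℚ) * ((n + 1 - 1 - k).factorial : ℚ)) =
        -3 / (2 * ((n : ℚ) + 1) * ((n : ℚ) + 2) * ((n : ℚ) + 3)) *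
          ((-2 : ℚ) ^ (k + 3) * ((n + 3).choose (k + 3) : ℚ)) := by
    intro k hk
    have hkn : k + 3 ≤ n + 3 := by
      have := Finset.mem_range.mp hk
      omega
    rw [Nat.cast_choose ℚ hkn, Nat.add_sub_cancel, Nat.add_sub_add_right,
      Nat.factorial_succ (k + 1), Nat.factorial_succ (n + 2), Nat.factorial_succ (n + 1),
      Nat.factorial_succ n]
    have h₁ := Nat.cast_ne_zero (R := ℚ).mpr (k + 1).factorial_ne_zero
    have h₂ := Nat.cast_ne_zero (R := ℚ).mpr (k + 3).factorial_ne_zero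
    have h₃ := Nat.cast_ne_zero (R := ℚ).mpr (n - k).factorial_ne_zero
    have h₄ : (k : ℚ) + 2 ≠ 0 := by positivity
    push_cast
    rw [show (k : ℚ) + 1 + 1 = k + 2 by ring, show (n : ℚ) + 2 + 1 = n + 3 by ring,
      show (n : ℚ) + 1 + 1 = n + 2 by ring]
    field_simp
    ring
  rw [Finset.sum_congr rfl hterm, ← Finset.mul_sum, sum_neg_two_pow_mul_choose_add_three]
  push_cast
  rw [show (n : ℚ) + 1 + 1 = n + 2 by ring, show (n : ℚ) + 1 + 2 = n + 3 by ring]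
  field_simp
  ring
end

section
/- For ε ∈ ℝ and an integer N ≥ 1 define S(ε,N) = Σ_{k=0}^{N−1} (−2)^k (k+2) Γ(4−ε) Γ(ε/2+3) Γ(N) Γ(k+2−ε/2) / (Γ(2−ε/2) Γ(k+4−ε) Γ(k+3+ε/2) Γ(N−k)), where Γ denotes the real Gamma function. Then for each integer N ≥ 1 the function ε ↦ S(ε,N) is differentiable at ε = 0 with derivative equal to (10N³+52N²+63N+10)/(8N(N+1)(N+2)²) − 3·S_1(N)/(2N(N+2)) + 3·S_{−1}(N)/(2N(N+2)) + (−1)^N(N−10)/(8N(N+1)(N+2)²), where S_1(N) = Σ_{k=1}^{N} 1/k and S_{−1}(N) = Σ_{k=1}^{N} (−1)^k/k. -/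
open Finset Filter Topology

/-- The `ε`-dependent Gamma quotient in the `k`-th summand of `S8`. -/
noncomputable def gammaQuot (k : ℕ) (ε : ℝ) : ℝ :=
  Real.Gamma (4 - ε) * Real.Gamma (ε / 2 + 3) * Real.Gamma ((k : ℝ) + 2 - ε / 2) /
    (Real.Gamma (2 - ε / 2) * Real.Gamma ((k : ℝ) + 4 - ε) * Real.Gamma ((k : ℝ) + 3 + ε / 2))

theorem gammaQuot_zero {ε : ℝ} (h₁ : -1 < ε) (h₂ : ε < 1) : gammaQuot 0 ε = 1 := by
  have a : Real.Gamma (4 - ε) ≠ 0 := (Real.Gamma_pos_of_pos (by linarith)).ne'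
  have b : Real.Gamma (3 + ε / 2) ≠ 0 := (Real.Gamma_pos_of_pos (by linarith)).ne'
  have c : Real.Gamma (2 - ε / 2) ≠ 0 := (Real.Gamma_pos_of_pos (by linarith)).ne'
  simp only [gammaQuot, Nat.cast_zero, zero_add, add_comm (ε / 2)]
  rw [mul_right_comm, mul_comm (Real.Gamma (4 - ε))]
  exact div_self (mul_ne_zero (mul_ne_zero c a) b)

theorem gammaQuot_succ (k : ℕ) {ε : ℝ} (h₁ : -1 < ε) (h₂ : ε < 1) :
    gammaQuot (k + 1) ε =
      gammaQuot k ε * ((k + 2 - ε / 2) / ((k + 4 - ε) * (k + 3 + ε / 2))) := by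
  have hk : (0 : ℝ) ≤ k := k.cast_nonneg
  have a : (k : ℝ) + 2 - ε / 2 ≠ 0 := by linarith
  have b : (k : ℝ) + 4 - ε ≠ 0 := by linarith
  have c : (k : ℝ) + 3 + ε / 2 ≠ 0 := by linarith
  unfold gammaQuot
  push_cast
  rw [show (k : ℝ) + 1 + 2 - ε / 2 = (k + 2 - ε / 2) + 1 by ring,
    show (k : ℝ) + 1 + 4 - ε = (k + 4 - ε) + 1 by ring,
    show (k : ℝ) + 1 + 3 + ε / 2 = (k + 3 + ε / 2) + 1 by ring,
    Real.Gamma_add_one a, Real.Gamma_add_one b, Real.Gamma_add_one c, div_mul_div_comm]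
  congr 1 <;> ring

theorem gammaQuot_at_zero (k : ℕ) :
    gammaQuot k 0 = 12 / ((k + 2) * ((k + 3).factorial : ℝ)) := by
  induction k with
  | zero => rw [gammaQuot_zero (by norm_num) (by norm_num)]; norm_num [Nat.factorial]
  | succ k ih =>
    rw [gammaQuot_succ k (by norm_num) (by norm_num), ih,
      show k + 1 + 3 = (k + 3) + 1 by ring, Nat.factorial_succ (k + 3)]
    have := Nat.factorial_ne_zero (k + 3)
    push_cast
    simp only [sub_zero, zero_div, add_zero]
    field_simp
    ring

theorem hasDerivAt_gammaQuot (k : ℕ) :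
    HasDerivAt (gammaQuot k)
      (gammaQuot k 0 * (1 / (k + 3) + 1 / (2 * (k + 2)) - 7 / 12)) 0 := by
  have hev : ∀ᶠ ε : ℝ in 𝓝 0, -1 < ε ∧ ε < 1 := Ioo_mem_nhds (by norm_num) (by norm_num)
  induction k with
  | zero =>
    refine ((hasDerivAt_const (0 : ℝ) (1 : ℝ)).congr_of_eventuallyEq ?_).congr_deriv ?_
    · filter_upwards [hev] with ε h using gammaQuot_zero h.1 h.2
    · norm_num
  | succ k ih =>
    have hhalf : HasDerivAt (fun ε : ℝ => ε / 2) (1 / 2) 0 := (hasDerivAt_id _).div_const 2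
    have hden : ((k : ℝ) + 4 - 0) * (k + 3 + 0 / 2) ≠ 0 := by
      have hk : (0 : ℝ) ≤ k := k.cast_nonneg
      norm_num
      constructor <;> linarith
    have hfactor := (hhalf.const_sub ((k : ℝ) + 2)).div
      (((hasDerivAt_id (0 : ℝ)).const_sub ((k : ℝ) + 4)).mul (hhalf.const_add ((k : ℝ) + 3))) hden
    refine ((ih.mul hfactor).congr_of_eventuallyEq ?_).congr_deriv ?_
    · filter_upwards [hev] with ε h
      simpa using gammaQuot_succ k h.1 h.2
    · rw [gammaQuot_succ k (by norm_num) (by norm_num)]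
      simp only [Pi.mul_apply, Pi.div_apply, id, sub_zero, zero_div, add_zero]
      push_cast
      field_simp
      ring

theorem sum_neg_two_pow_mul_choose (M : ℕ) :
    ∑ m ∈ range (M + 1), (-2 : ℝ) ^ m * M.choose m = (-1) ^ M := by
  have := add_pow (-2 : ℝ) 1 M
  norm_num at this
  exact this.symm

theorem sum_neg_two_pow_mul_choose_div_succ (M : ℕ) :
    ∑ m ∈ range M, (-2 : ℝ) ^ (m + 1) * M.choose (m + 1) / (m + 1) =
      ∑ k ∈ Icc 1 M, (-1 : ℝ) ^ k / k - ∑ k ∈ Icc 1 M, 1 / (k : ℝ) := by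
  induction M with
  | zero => simp
  | succ M ih =>
    have hpascal : ∀ m ∈ range (M + 1),
        (-2 : ℝ) ^ (m + 1) * (M + 1).choose (m + 1) / (m + 1) =
          (-2 : ℝ) ^ (m + 1) * (M + 1).choose (m + 1) / (M + 1) +
            (-2 : ℝ) ^ (m + 1) * M.choose (m + 1) / (m + 1) := by
      intro m _
      have habsorb : ((M : ℝ) + 1) * M.choose m = (M + 1).choose (m + 1) * (m + 1) := by
        exact_mod_cast Nat.add_one_mul_choose_eq M m
      have hsplit : (((M + 1).choose (m + 1) : ℕ) : ℝ) = M.choose m + M.choose (m + 1) := by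
        exact_mod_cast Nat.choose_succ_succ M m
      have hdiv : ((M + 1).choose (m + 1) : ℝ) / (M + 1) = M.choose m / (m + 1) := by
        field_simp
        linarith
      rw [mul_div_assoc _ _ ((M : ℝ) + 1), hdiv, hsplit]
      ring
    have hfull := sum_neg_two_pow_mul_choose (M + 1)
    rw [sum_range_succ'] at hfull
    rw [sum_congr rfl hpascal, sum_add_distrib, ← sum_div,
      sum_Icc_succ_top (by lia), sum_Icc_succ_top (by lia), eq_sub_of_add_eq hfull,
      sum_range_succ (fun m : ℕ => (-2 : ℝ) ^ (m + 1) * M.choose (m + 1) / (m + 1)), ih]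
    simp
    ring

theorem sum_neg_two_pow_mul_choose_add_two_div_succ (M : ℕ) :
    ∑ m ∈ range M, (-2 : ℝ) ^ (m + 2) * M.choose (m + 2) / (m + 1) =
      -2 * M * (∑ k ∈ Icc 1 M, (-1 : ℝ) ^ k / k - ∑ k ∈ Icc 1 M, 1 / (k : ℝ)) +
        (-1) ^ M - 1 - 2 * M := by
  induction M with
  | zero => simp
  | succ M ih =>
    have hpascal : ∀ m ∈ range (M + 1),
        (-2 : ℝ) ^ (m + 2) * (M + 1).choose (m + 2) / (m + 1) =
          -2 * ((-2 : ℝ) ^ (m + 1) * M.choose (m + 1) / (m + 1)) +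
            (-2 : ℝ) ^ (m + 2) * M.choose (m + 2) / (m + 1) := by
      intro m _
      rw [Nat.choose_succ_succ M (m + 1)]
      push_cast
      ring
    rw [sum_congr rfl hpascal, sum_add_distrib, ← mul_sum, sum_range_succ, sum_range_succ, ih,
      sum_neg_two_pow_mul_choose_div_succ, sum_Icc_succ_top (by lia), sum_Icc_succ_top (by lia),
      Nat.choose_eq_zero_of_lt (by lia : M < M + 1), Nat.choose_eq_zero_of_lt (by lia : M < M + 2)]
    push_cast
    field_simp
    ring

/-- (Equ:SingleSumF1): the linear coefficient `F_1(N)` of the ε-expansion of the single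
sum (Equ:SimpleSumProblem), as the derivative at `ε = 0`. -/
theorem stmt_10 (N : ℕ) (hN : 1 ≤ N) :
    HasDerivAt (fun ε : ℝ => S8 ε N)
      ((10 * (N : ℝ) ^ 3 + 52 * (N : ℝ) ^ 2 + 63 * (N : ℝ) + 10) /
          (8 * (N : ℝ) * ((N : ℝ) + 1) * ((N : ℝ) + 2) ^ 2) -
        3 * (∑ k ∈ Finset.Icc 1 N, 1 / (k : ℝ)) / (2 * (N : ℝ) * ((N : ℝ) + 2)) +
        3 * (∑ k ∈ Finset.Icc 1 N, (-1 : ℝ) ^ k / (k : ℝ)) /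
          (2 * (N : ℝ) * ((N : ℝ) + 2)) +
        (-1 : ℝ) ^ N * ((N : ℝ) - 10) /
          (8 * (N : ℝ) * ((N : ℝ) + 1) * ((N : ℝ) + 2) ^ 2)) 0 := by
  have hN0 : (N : ℝ) ≠ 0 := by positivity
  have hS : (fun ε : ℝ => S8 ε N) = fun ε => ∑ k ∈ range N,
      (-2 : ℝ) ^ k * ((k : ℝ) + 2) * (Real.Gamma N / Real.Gamma ((N : ℝ) - k)) *
        gammaQuot k ε := by
    funext ε
    refine sum_congr rfl fun k _ => ?_
    rw [gammaQuot, mul_assoc _ (Real.Gamma N / _), div_mul_div_comm, ← mul_div_assoc]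
    congr 1 <;> ring
  rw [hS]
  refine (HasDerivAt.fun_sum fun k _ => (hasDerivAt_gammaQuot k).const_mul _).congr_deriv ?_
  have hterm : ∀ k ∈ range N,
      (-2 : ℝ) ^ k * ((k : ℝ) + 2) * (Real.Gamma N / Real.Gamma ((N : ℝ) - k)) *
        (gammaQuot k 0 * (1 / (k + 3) + 1 / (2 * (k + 2)) - 7 / 12)) =
      -3 / (2 * N * (N + 1) * (N + 2)) *
        ((-2 : ℝ) ^ (k + 3) * (N + 2).choose (k + 3) / (k + 3) +
          1 / 2 * ((-2 : ℝ) ^ (k + 3) * (N + 2).choose (k + 3) / (k + 2)) -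
          7 / 12 * ((-2 : ℝ) ^ (k + 3) * (N + 2).choose (k + 3))) := by
    intro k hk
    obtain ⟨d, rfl⟩ : ∃ d, N = k + d + 1 := ⟨N - k - 1, by have := mem_range.1 hk; lia⟩
    have hchoose : (((k + d + 1 + 2).choose (k + 3) : ℕ) : ℝ) =
        (k + d + 3) * (k + d + 2) * (k + d + 1) * (k + d).factorial /
          ((k + 3).factorial * d.factorial) := by
      rw [show k + d + 1 + 2 = (k + 3) + d by ring, Nat.cast_add_choose,
        show k + 3 + d = k + d + 1 + 1 + 1 by ring, Nat.factorial_succ, Nat.factorial_succ,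
        Nat.factorial_succ]
      push_cast
      ring
    rw [gammaQuot_at_zero, hchoose,
      show (((k + d + 1 : ℕ) : ℝ) - k) = (d : ℝ) + 1 by push_cast; ring, Real.Gamma_nat_eq_factorial,
      Nat.cast_add_one, Real.Gamma_nat_eq_factorial]
    have h₁ := Nat.factorial_ne_zero (k + 3)
    have h₂ := Nat.factorial_ne_zero d
    have h₃ : (k : ℝ) + d + 1 ≠ 0 := by positivity
    push_cast
    field_simp
    ring
  have hA := sum_neg_two_pow_mul_choose (N + 2)
  have hB := sum_neg_two_pow_mul_choose_div_succ (N + 2)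
  have hC := sum_neg_two_pow_mul_choose_add_two_div_succ (N + 2)
  rw [sum_range_succ', sum_range_succ', sum_range_succ'] at hA
  rw [sum_range_succ', sum_range_succ'] at hB
  rw [sum_range_succ, sum_range_succ'] at hC
  rw [sum_Icc_succ_top (by lia), sum_Icc_succ_top (by lia), sum_Icc_succ_top (by lia),
    sum_Icc_succ_top (by lia)] at hB hC
  rw [sum_congr rfl hterm, ← mul_sum, sum_sub_distrib, sum_add_distrib, ← mul_sum, ← mul_sum]
  have hchoose_two : (((N + 2).choose 2 : ℕ) : ℝ) = (N + 2) * (N + 1) / 2 := by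
    rw [Nat.cast_choose_two]
    push_cast
    ring
  norm_num [add_assoc, hchoose_two] at hA hB hC
  norm_num only [one_div]
  rw [eq_sub_of_add_eq hA, eq_sub_of_add_eq hB, eq_sub_of_add_eq hC]
  simp only [pow_succ]
  field_simp
  ring
end

section
/- For every integer N ≥ 1 the following identity holds in ℚ: (−1/(2N(N+2))) · Σ_{i₁=1}^{N} [ (−1)^{i₁}(2i₁+1)/(i₁(i₁+1)) · Σ_{i₂=1}^{i₁} ( −24·(−1)^{i₂}·i₂³ / ((2i₂−1)(2i₂+1)) ) ] = 3(2N²+4N+1)/(2N(N+1)(N+2)) − 3(−1)^N/(2N(N+1)(N+2)). -/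
/-- Closed form of the inner alternating sum. -/
theorem sum_Icc_alternating_cube_div (n : ℕ) :
    ∑ i ∈ Finset.Icc 1 n,
        -24 * (-1 : ℚ) ^ i * (i : ℚ) ^ 3 / ((2 * (i : ℚ) - 1) * (2 * (i : ℚ) + 1)) =
      -(3 / 2) * (-1 : ℚ) ^ n *
        ((2 * (n : ℚ) + 1) - 2 * (-1 : ℚ) ^ n + 1 / (2 * (n : ℚ) + 1)) := by
  induction n with
  | zero => norm_num
  | succ k ih =>
    rw [Finset.sum_Icc_succ_top (by omega), ih]
    have hk : (2 * (k : ℚ) + 1) ≠ 0 := by positivity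
    have hk' : (2 * ((k : ℚ) + 1) + 1) ≠ 0 := by positivity
    have hden : 2 * ((k : ℚ) + 1) - 1 = 2 * (k : ℚ) + 1 := by ring
    push_cast
    rw [hden, pow_succ (-1 : ℚ) k]
    rcases neg_one_pow_eq_or ℚ k with h | h <;> rw [h] <;> field_simp <;> ring

/-- Closed form of the outer sum. -/
theorem sum_Icc_alternating_double_sum (n : ℕ) :
    ∑ i₁ ∈ Finset.Icc 1 n,
        (-1 : ℚ) ^ i₁ * (2 * (i₁ : ℚ) + 1) / ((i₁ : ℚ) * ((i₁ : ℚ) + 1)) *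
          ∑ i₂ ∈ Finset.Icc 1 i₁,
            -24 * (-1 : ℚ) ^ i₂ * (i₂ : ℚ) ^ 3 /
              ((2 * (i₂ : ℚ) - 1) * (2 * (i₂ : ℚ) + 1)) =
      -3 * (2 * (n : ℚ) ^ 2 + 4 * (n : ℚ) + 1 - (-1 : ℚ) ^ n) / ((n : ℚ) + 1) := by
  induction n with
  | zero => norm_num
  | succ k ih =>
    rw [Finset.sum_Icc_succ_top (by omega), ih, sum_Icc_alternating_cube_div]
    have hk : (k : ℚ) + 1 ≠ 0 := by positivity
    have hk' : (k : ℚ) + 1 + 1 ≠ 0 := by positivity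
    have hk'' : (2 * ((k : ℚ) + 1) + 1) ≠ 0 := by positivity
    push_cast
    rw [pow_succ (-1 : ℚ) k]
    rcases neg_one_pow_eq_or ℚ k with h | h <;> rw [h] <;> field_simp <;> ring

/-- The double-sum representation (Equ:NSSingleSumF0) of the constant term `F_0(N)`
equals the closed form (Equ:SingleSumF0). -/
theorem stmt_11 (N : ℕ) (hN : 1 ≤ N) :
    (-1 : ℚ) / (2 * (N : ℚ) * ((N : ℚ) + 2)) *
        ∑ i₁ ∈ Finset.Icc 1 N,
          (-1 : ℚ) ^ i₁ * (2 * (i₁ : ℚ) + 1) / ((i₁ : ℚ) * ((i₁ : ℚ) + 1)) *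
            ∑ i₂ ∈ Finset.Icc 1 i₁,
              -24 * (-1 : ℚ) ^ i₂ * (i₂ : ℚ) ^ 3 /
                ((2 * (i₂ : ℚ) - 1) * (2 * (i₂ : ℚ) + 1)) =
      3 * (2 * (N : ℚ) ^ 2 + 4 * (N : ℚ) + 1) /
          (2 * (N : ℚ) * ((N : ℚ) + 1) * ((N : ℚ) + 2)) -
        3 * (-1 : ℚ) ^ N / (2 * (N : ℚ) * ((N : ℚ) + 1) * ((N : ℚ) + 2)) := by
  rw [sum_Icc_alternating_double_sum]
  have hN₀ : (N : ℚ) ≠ 0 := by positivity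
  have hN₁ : (N : ℚ) + 1 ≠ 0 := by positivity
  have hN₂ : (N : ℚ) + 2 ≠ 0 := by positivity
  field_simp
end

section
/- Let K be a field of characteristic 0 and let X : ℤ → K be any function. Define G : {N ∈ ℕ : N ≥ 1} → K by G(N) = (−1/(2N(N+2))) · Σ_{i₁=1}^{N} [ (−1)^{i₁}(2i₁+1)/(i₁(i₁+1)) · Σ_{i₂=1}^{i₁} ( (−1)^{i₂}·i₂²·X(i₂−2) / ((2i₂−1)(2i₂+1)) ) ]. Then for every integer N ≥ 1: 2N(N+1)(2N+5)·G(N) + (N+1)(4N+12)·G(N+1) + (−N−4)(2N+3)(2N+6)·G(N+2) = X(N). -/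
/-- The generic particular solution (last summand of (Equ:GenericSolSingleSum)) of the
recurrence with coefficients `a₀(0,N), a₁(0,N), a₂(0,N)` from (Equ:SingleSumRecCoef). -/
noncomputable def G12 (K : Type*) [Field K] (X : ℤ → K) (N : ℕ) : K :=
  (-1 : K) / (2 * (N : K) * ((N : K) + 2)) *
    ∑ i₁ ∈ Finset.Icc 1 N,
      (-1 : K) ^ i₁ * (2 * (i₁ : K) + 1) / ((i₁ : K) * ((i₁ : K) + 1)) *
        ∑ i₂ ∈ Finset.Icc 1 i₁,
          (-1 : K) ^ i₂ * (i₂ : K) ^ 2 * X ((i₂ : ℤ) - 2) /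
            ((2 * (i₂ : K) - 1) * (2 * (i₂ : K) + 1))

/-- The double-sum expression `G12` solves
`a₀(0,N)·F(N) + a₁(0,N)·F(N+1) + a₂(0,N)·F(N+2) = X(N)` for `N ≥ 1`. -/
theorem stmt_12 (K : Type*) [Field K] [CharZero K] (X : ℤ → K) :
    ∀ N : ℕ, 1 ≤ N →
      2 * (N : K) * ((N : K) + 1) * (2 * (N : K) + 5) * G12 K X N +
          ((N : K) + 1) * (4 * (N : K) + 12) * G12 K X (N + 1) +
          (-(N : K) - 4) * (2 * (N : K) + 3) * (2 * (N : K) + 6) * G12 K X (N + 2) =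
        X (N : ℤ) := by
  intro N hN
  have hN0 : (N : K) ≠ 0 := by exact_mod_cast (show N ≠ 0 by omega)
  have h1 : (N : K) + 1 ≠ 0 := by exact_mod_cast (show N + 1 ≠ 0 by omega)
  have h2 : (N : K) + 2 ≠ 0 := by exact_mod_cast (show N + 2 ≠ 0 by omega)
  have h3 : (N : K) + 3 ≠ 0 := by exact_mod_cast (show N + 3 ≠ 0 by omega)
  have h4 : (N : K) + 4 ≠ 0 := by exact_mod_cast (show N + 4 ≠ 0 by omega)
  have h23 : 2 * (N : K) + 3 ≠ 0 := by exact_mod_cast (show 2 * N + 3 ≠ 0 by omega)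
  have h25 : 2 * (N : K) + 5 ≠ 0 := by exact_mod_cast (show 2 * N + 5 ≠ 0 by omega)
  have hsq : ((-1 : K) ^ N) ^ 2 = 1 := by rw [← pow_mul, mul_comm, pow_mul]; simp
  have hX : ((N + 1 + 1 : ℕ) : ℤ) - 2 = N := by push_cast; ring
  unfold G12
  -- Split off the top outer terms at `N + 1`, `N + 2` and the top inner term at `N + 2`.
  rw [show N + 2 = N + 1 + 1 from rfl,
    Finset.sum_Icc_succ_top (show 1 ≤ N + 1 + 1 by omega),
    Finset.sum_Icc_succ_top (show 1 ≤ N + 1 by omega),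
    Finset.sum_Icc_succ_top (show 1 ≤ N + 1 + 1 by omega), hX]
  generalize (∑ i₁ ∈ Finset.Icc 1 N, _ : K) = S
  generalize (∑ i₂ ∈ Finset.Icc 1 (N + 1), _ : K) = T
  generalize X N = x
  push_cast
  rw [pow_succ _ (N + 1), pow_succ _ N]
  generalize (-1 : K) ^ N = e at hsq ⊢
  generalize (N : K) = n at *
  rw [show n + 1 + 1 = n + 2 by ring, show n + 1 + 2 = n + 3 by ring,
    show n + 2 + 1 = n + 3 by ring, show n + 2 + 2 = n + 4 by ring,
    show 2 * (n + 1) + 1 = 2 * n + 3 by ring, show 2 * (n + 2) + 1 = 2 * n + 5 by ring,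
    show 2 * (n + 2) - 1 = 2 * n + 3 by ring]
  field_simp
  linear_combination (n + 4) * (2 * n + 6) * (n + 1) * (n + 2) ^ 2 * x * hsq
end

section
/- Let K be a field of characteristic 0, let X : ℤ → K be any function and let c₁, c₂ ∈ K. Define G : {N ∈ ℕ : N ≥ 1} → K by G(N) = c₁/(N(N+2)) + c₂·(−1)^{N+1}/(2N(N+1)(N+2)) − (1/(2N(N+2)))·Σ_{i₁=1}^{N} i₁·X(i₁−2)/((2i₁−1)(2i₁+1)) − ((−1)^N/(2N(N+1)(N+2)))·Σ_{i₁=1}^{N} (−1)^{i₁}·i₁²·X(i₁−2)/((2i₁−1)(2i₁+1)). Then for every integer N ≥ 1: 2N(N+1)(2N+5)·G(N) + (N+1)(4N+12)·G(N+1) + (−N−4)(2N+3)(2N+6)·G(N+2) = X(N). -/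
/-- The depth-optimal generic solution ('Simplification 2' of the paper) of the
recurrence with coefficients `a₀(0,N), a₁(0,N), a₂(0,N)` from (Equ:SingleSumRecCoef). -/
noncomputable def G13 (K : Type*) [Field K] (X : ℤ → K) (c₁ c₂ : K) (N : ℕ) : K :=
  c₁ / ((N : K) * ((N : K) + 2)) +
    c₂ * (-1 : K) ^ (N + 1) / (2 * (N : K) * ((N : K) + 1) * ((N : K) + 2)) -
    1 / (2 * (N : K) * ((N : K) + 2)) *
      ∑ i₁ ∈ Finset.Icc 1 N,
        (i₁ : K) * X ((i₁ : ℤ) - 2) / ((2 * (i₁ : K) - 1) * (2 * (i₁ : K) + 1)) -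
    (-1 : K) ^ N / (2 * (N : K) * ((N : K) + 1) * ((N : K) + 2)) *
      ∑ i₁ ∈ Finset.Icc 1 N,
        (-1 : K) ^ i₁ * (i₁ : K) ^ 2 * X ((i₁ : ℤ) - 2) /
          ((2 * (i₁ : K) - 1) * (2 * (i₁ : K) + 1))

/-- The single-sum expression `G13` solves
`a₀(0,N)·F(N) + a₁(0,N)·F(N+1) + a₂(0,N)·F(N+2) = X(N)` for `N ≥ 1`. -/
theorem stmt_13 (K : Type*) [Field K] [CharZero K] (X : ℤ → K) (c₁ c₂ : K) :
    ∀ N : ℕ, 1 ≤ N →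
      2 * (N : K) * ((N : K) + 1) * (2 * (N : K) + 5) * G13 K X c₁ c₂ N +
          ((N : K) + 1) * (4 * (N : K) + 12) * G13 K X c₁ c₂ (N + 1) +
          (-(N : K) - 4) * (2 * (N : K) + 3) * (2 * (N : K) + 6) * G13 K X c₁ c₂ (N + 2) =
        X (N : ℤ) := by
  intro N hN
  have h0 : (N : K) ≠ 0 := by exact_mod_cast (by omega : N ≠ 0)
  have h1 : (N : K) + 1 ≠ 0 := by exact_mod_cast (by omega : N + 1 ≠ 0)
  have h2 : (N : K) + 2 ≠ 0 := by exact_mod_cast (by omega : N + 2 ≠ 0)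
  have h3 : (N : K) + 3 ≠ 0 := by exact_mod_cast (by omega : N + 3 ≠ 0)
  have h4 : (N : K) + 4 ≠ 0 := by exact_mod_cast (by omega : N + 4 ≠ 0)
  have d1 : 2 * (N : K) + 1 ≠ 0 := by exact_mod_cast (by omega : 2 * N + 1 ≠ 0)
  have d3 : 2 * (N : K) + 3 ≠ 0 := by exact_mod_cast (by omega : 2 * N + 3 ≠ 0)
  have d5 : 2 * (N : K) + 5 ≠ 0 := by exact_mod_cast (by omega : 2 * N + 5 ≠ 0)
  have x1 : ((N + 1 : ℕ) : ℤ) - 2 = N - 1 := by push_cast; ring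
  have x2 : ((N + 1 + 1 : ℕ) : ℤ) - 2 = N := by push_cast; ring
  have hs : ((-1 : K) ^ N) ^ 2 = 1 := by rw [← pow_mul, mul_comm, pow_mul]; simp
  simp only [G13, show N + 2 = N + 1 + 1 from rfl,
    Finset.sum_Icc_succ_top (show 1 ≤ N + 1 by omega),
    Finset.sum_Icc_succ_top (show 1 ≤ N + 1 + 1 by omega), x1, x2]
  generalize ∑ i₁ ∈ Finset.Icc 1 N, (i₁ : K) * X ((i₁ : ℤ) - 2) /
    ((2 * (i₁ : K) - 1) * (2 * (i₁ : K) + 1)) = S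
  generalize ∑ i₁ ∈ Finset.Icc 1 N, (-1 : K) ^ i₁ * (i₁ : K) ^ 2 * X ((i₁ : ℤ) - 2) /
    ((2 * (i₁ : K) - 1) * (2 * (i₁ : K) + 1)) = T
  simp only [pow_succ (-1 : K)]
  generalize (-1 : K) ^ N = s at *
  generalize X N = x
  generalize X (N - 1) = y
  push_cast
  generalize (N : K) = n at *
  have e1 : n + 1 + 2 = n + 3 := by ring
  have e2 : n + 1 + 1 = n + 2 := by ring
  have e3 : n + 2 + 2 = n + 4 := by ring
  have e4 : n + 2 + 1 = n + 3 := by ring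
  have e5 : 2 * (n + 1) - 1 = 2 * n + 1 := by ring
  have e6 : 2 * (n + 1) + 1 = 2 * n + 3 := by ring
  have e7 : 2 * (n + 2) - 1 = 2 * n + 3 := by ring
  have e8 : 2 * (n + 2) + 1 = 2 * n + 5 := by ring
  simp only [e1, e2, e3, e4, e5, e6, e7, e8]
  field_simp
  ring_nf
  simp only [hs]
  ring
end

section
/- For x ∈ ℝ and k ∈ ℕ let (x)_k = ∏_{i=0}^{k−1}(x+i) denote the Pochhammer symbol, and for ε ∈ ℝ and natural numbers N, j₀, j₁ define F(ε;N,j₀,j₁) = (−1)^{j₁}(j₁+1)·C(N−2−j₀, j₁+1)·(j₀+j₁)!·(1−ε/2)_{j₀}·(3−ε/2)_{j₁} / ((4−ε)_{j₀+j₁}·(ε/2+4)_{j₀+j₁}), where C(n,k) is the binomial coefficient. Define e(ε;N,j₀,j₁) = ε² + j₀ε + ε − 2j₁ − 2j₀N − 4j₁N − 12N − 6, d₁(ε;N,j₀,j₁) = (ε−2N)(j₀+j₁−N+1), and d₂(ε;N,j₀,j₁) = −2N² + εN + 2j₀N + 4j₁N + 4N − 2ε − εj₀ + 2j₁. Then for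 all real ε with |ε| < 1 and all natural numbers N, j₀, j₁ with N ≥ 4 and j₀ + j₁ ≤ N − 4: (ε−2N)·N·F(ε;N,j₀,j₁) − (ε−N−3)(ε+2N+2)·F(ε;N+1,j₀,j₁) = [e(ε;N,j₀+1,j₁)·F(ε;N+1,j₀+1,j₁) − e(ε;N,j₀,j₁)·F(ε;N+1,j₀,j₁)] + [d₁(ε;N,j₀,j₁+1)·F(ε;N,j₀,j₁+1) − d₁(ε;N,j₀,j₁)·F(ε;N,j₀,j₁)] + [d₂(ε;N,j₀,j₁+1)·F(ε;N+1,j₀,j₁+1) − d₂(ε;N,j₀,j₁)·F(ε;N+1,j₀,j₁)]. -/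
/-- The Pochhammer symbol `(x)_k = ∏_{i=0}^{k-1} (x+i)` for real `x`. -/
noncomputable def poch (x : ℝ) (k : ℕ) : ℝ := ∏ i ∈ Finset.range k, (x + (i : ℝ))

/-- The proper hypergeometric summand of the double sum (Ex-75). -/
noncomputable def F14 (ε : ℝ) (N j₀ j₁ : ℕ) : ℝ :=
  (-1 : ℝ) ^ j₁ * ((j₁ : ℝ) + 1) * ((N - 2 - j₀).choose (j₁ + 1) : ℝ) *
      ((j₀ + j₁).factorial : ℝ) * poch (1 - ε / 2) j₀ * poch (3 - ε / 2) j₁ /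
    (poch (4 - ε) (j₀ + j₁) * poch (ε / 2 + 4) (j₀ + j₁))

/-- The coefficient `e` of the `Δ_{j₀}`-part of the certificate recurrence. -/
def e14 (ε : ℝ) (N j₀ j₁ : ℕ) : ℝ :=
  ε ^ 2 + (j₀ : ℝ) * ε + ε - 2 * (j₁ : ℝ) - 2 * (j₀ : ℝ) * (N : ℝ) -
    4 * (j₁ : ℝ) * (N : ℝ) - 12 * (N : ℝ) - 6

/-- The first coefficient of the `Δ_{j₁}`-part of the certificate recurrence. -/
def d₁14 (ε : ℝ) (N j₀ j₁ : ℕ) : ℝ :=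
  (ε - 2 * (N : ℝ)) * ((j₀ : ℝ) + (j₁ : ℝ) - (N : ℝ) + 1)

/-- The second coefficient of the `Δ_{j₁}`-part of the certificate recurrence. -/
def d₂14 (ε : ℝ) (N j₀ j₁ : ℕ) : ℝ :=
  -2 * (N : ℝ) ^ 2 + ε * (N : ℝ) + 2 * (j₀ : ℝ) * (N : ℝ) + 4 * (j₁ : ℝ) * (N : ℝ) +
    4 * (N : ℝ) - 2 * ε - ε * (j₀ : ℝ) + 2 * (j₁ : ℝ)

theorem poch_succ (x : ℝ) (k : ℕ) : poch x (k + 1) = poch x k * (x + k) :=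
  Finset.prod_range_succ _ _

theorem poch_pos {x : ℝ} (hx : 0 < x) (k : ℕ) : 0 < poch x k :=
  Finset.prod_pos fun _ _ => by positivity

/-- `C(n+1, k) = C(n, k) (n+1) / (n+1-k)`, with `n = k + l`. -/
theorem cast_choose_succ_left (k l : ℕ) :
    ((k + l + 1).choose k : ℝ) = (k + l).choose k * ((k + l + 1 : ℝ) / (l + 1)) := by
  have h := Nat.choose_mul_succ_eq (k + l) k
  rw [show k + l + 1 - k = l + 1 by omega] at h
  have h' : ((k + l).choose k : ℝ) * (k + l + 1) = (k + l + 1).choose k * (l + 1) := by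
    exact_mod_cast h
  have : (l : ℝ) + 1 ≠ 0 := by positivity
  field_simp
  linarith

/-- `C(n, k+1) = C(n, k) (n-k) / (k+1)`, with `n = k + l`. -/
theorem cast_choose_succ_right (k l : ℕ) :
    ((k + l).choose (k + 1) : ℝ) = (k + l).choose k * ((l : ℝ) / (k + 1)) := by
  have h := Nat.choose_succ_right_eq (k + l) k
  rw [Nat.add_sub_cancel_left] at h
  have h' : ((k + l).choose (k + 1) : ℝ) * (k + 1) = (k + l).choose k * l := by
    exact_mod_cast h
  have : (k : ℝ) + 1 ≠ 0 := by positivity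
  field_simp
  linarith

/-- The certificate recurrence (Equ:Certificate) for the summand of (Ex-75). -/
theorem stmt_14 :
    ∀ ε : ℝ, |ε| < 1 → ∀ N j₀ j₁ : ℕ, 4 ≤ N → j₀ + j₁ ≤ N - 4 →
      (ε - 2 * (N : ℝ)) * (N : ℝ) * F14 ε N j₀ j₁ -
          (ε - (N : ℝ) - 3) * (ε + 2 * (N : ℝ) + 2) * F14 ε (N + 1) j₀ j₁ =
        (e14 ε N (j₀ + 1) j₁ * F14 ε (N + 1) (j₀ + 1) j₁ -
            e14 ε N j₀ j₁ * F14 ε (N + 1) j₀ j₁) +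
          (d₁14 ε N j₀ (j₁ + 1) * F14 ε N j₀ (j₁ + 1) -
            d₁14 ε N j₀ j₁ * F14 ε N j₀ j₁) +
          (d₂14 ε N j₀ (j₁ + 1) * F14 ε (N + 1) j₀ (j₁ + 1) -
            d₂14 ε N j₀ j₁ * F14 ε (N + 1) j₀ j₁) := by
  intro ε hε N a b hN hab
  obtain ⟨h₁, h₂⟩ := abs_lt.mp hε
  obtain ⟨m, rfl⟩ : ∃ m, N = a + b + 4 + m := ⟨N - 4 - (a + b), by omega⟩
  have s₁ : a + b + 4 + m - 2 - a = b + 1 + (m + 1) := by omega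
  have s₂ : a + b + 4 + m + 1 - 2 - a = b + 1 + (m + 1) + 1 := by omega
  have s₃ : a + b + 4 + m + 1 - 2 - (a + 1) = b + 1 + (m + 1) := by omega
  have c₁ := cast_choose_succ_left (b + 1) (m + 1)
  have c₂ := cast_choose_succ_right (b + 1) (m + 1)
  have c₃ : ((b + 1 + (m + 1) + 1).choose (b + 1 + 1) : ℝ) =
      (b + 1 + (m + 1)).choose (b + 1) + (b + 1 + (m + 1)).choose (b + 1 + 1) := by
    exact_mod_cast Nat.choose_succ_succ _ _
  have p₁ := (poch_pos (x := 4 - ε) (by linarith) (a + b)).ne'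
  have p₂ := (poch_pos (x := ε / 2 + 4) (by linarith) (a + b)).ne'
  have q₁ : 4 - ε + ((a : ℝ) + b) ≠ 0 := by
    have : 0 ≤ (a : ℝ) + b := by positivity
    linarith
  have q₂ : ε / 2 + 4 + ((a : ℝ) + b) ≠ 0 := by
    have : 0 ≤ (a : ℝ) + b := by positivity
    linarith
  simp only [F14, e14, d₁14, d₂14, s₁, s₂, s₃, c₃, c₂, c₁,
    show a + 1 + b = a + b + 1 by omega, show a + (b + 1) = a + b + 1 by omega,
    poch_succ, Nat.factorial_succ, pow_succ]
  push_cast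
  generalize poch (4 - ε) (a + b) = P at *
  generalize poch (ε / 2 + 4) (a + b) = Q at *
  generalize poch (1 - ε / 2) a = A
  generalize poch (3 - ε / 2) b = B
  generalize ((a + b).factorial : ℝ) = f
  generalize ((b + 1 + (m + 1)).choose (b + 1) : ℝ) = c
  generalize (-1 : ℝ) ^ b = s
  have r₁ : (m : ℝ) + 1 + 1 ≠ 0 := by positivity
  have r₂ : (b : ℝ) + 1 + 1 ≠ 0 := by positivity
  have q₃ : ε + 2 * 4 + 2 * ((a : ℝ) + b) ≠ 0 := fun h => q₂ (by linarith)
  field_simp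
  ring
end

section
/- For x ∈ ℝ and k ∈ ℕ let (x)_k = ∏_{i=0}^{k−1}(x+i) denote the Pochhammer symbol, and for ε ∈ ℝ and natural numbers N, j₀, j₁ define F(ε;N,j₀,j₁) = (−1)^{j₁}(j₁+1)·C(N−2−j₀, j₁+1)·(j₀+j₁)!·(1−ε/2)_{j₀}·(3−ε/2)_{j₁} / ((4−ε)_{j₀+j₁}·(ε/2+4)_{j₀+j₁}), where C(n,k) is the binomial coefficient. Then for every integer N ≥ 3 the function ε ↦ Σ_{j₀=0}^{N−3} Σ_{j₁=0}^{N−3−j₀} F(ε;N,j₀,j₁) is differentiable at ε = 0 with derivative equal to 3(N⁴−13N³−28N²−32N+24)/(8N³(N+2)) + 9(N+3)·S_1(N)/(N(N+1)(N+2)), where S_1(N) = Σ_{k=1}^{N} 1/k. -/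
/-- The `m`-th alternating binomial sum of `f`. -/
noncomputable def altSum (f : ℕ → ℝ) (m : ℕ) : ℝ :=
  ∑ k ∈ Finset.range (m + 1), (-1 : ℝ) ^ k * (m.choose k : ℝ) * f k

theorem poch_zero (x : ℝ) : poch x 0 = 1 := by simp [poch]

theorem poch_succ_left (x : ℝ) (k : ℕ) : poch x (k + 1) = x * poch (x + 1) k := by
  rw [poch, Finset.prod_range_succ', mul_comm, poch]
  congr 1
  · simp
  · exact Finset.prod_congr rfl fun i _ => by push_cast; ring

theorem altSum_succ (f : ℕ → ℝ) (m : ℕ) :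
    altSum f (m + 1) = altSum f m - altSum (fun k => f (k + 1)) m := by
  have h : altSum f m = ∑ k ∈ Finset.range (m + 1),
      (-1 : ℝ) ^ (k + 1) * (m.choose (k + 1) : ℝ) * f (k + 1) + f 0 := by
    rw [Finset.sum_range_succ, altSum, Finset.sum_range_succ']
    simp
  rw [h, altSum, Finset.sum_range_succ', altSum, add_sub_right_comm, ← Finset.sum_sub_distrib]
  congr 1
  · refine Finset.sum_congr rfl fun k _ => ?_
    rw [Nat.choose_succ_succ]
    push_cast
    ring
  · simp

theorem altSum_add (f g : ℕ → ℝ) (m : ℕ) :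
    altSum (fun k => f k + g k) m = altSum f m + altSum g m := by
  simp [altSum, mul_add, Finset.sum_add_distrib]

theorem altSum_const_mul (c : ℝ) (f : ℕ → ℝ) (m : ℕ) :
    altSum (fun k => c * f k) m = c * altSum f m := by
  rw [altSum, altSum, Finset.mul_sum]
  exact Finset.sum_congr rfl fun k _ => by ring

theorem altSum_one_div (m : ℕ) {j : ℝ} (hj : 0 < j) :
    altSum (fun k => 1 / ((k : ℝ) + j)) m = (m.factorial : ℝ) / poch j (m + 1) := by
  induction m generalizing j with
  | zero => simp [altSum, poch]
  | succ m ih =>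
    have h : (fun k : ℕ => 1 / (((k + 1 : ℕ) : ℝ) + j)) = fun k : ℕ => 1 / ((k : ℝ) + (j + 1)) := by
      funext k; push_cast; ring
    rw [altSum_succ, h, ih hj, ih (by positivity), Nat.factorial_succ, poch_succ_left j m,
      poch_succ_left j (m + 1), poch_succ (j + 1) m]
    have := poch_pos (add_pos hj one_pos) m
    have : j + 1 + m ≠ 0 := by positivity
    push_cast
    field_simp
    ring

theorem altSum_one_div_sq (m : ℕ) {j : ℝ} (hj : 0 < j) :
    altSum (fun k => 1 / ((k : ℝ) + j) ^ 2) m =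
      (m.factorial : ℝ) / poch j (m + 1) * ∑ i ∈ Finset.range (m + 1), 1 / (j + i) := by
  induction m generalizing j with
  | zero => simp [altSum, poch]; field_simp
  | succ m ih =>
    have h : (fun k : ℕ => 1 / (((k + 1 : ℕ) : ℝ) + j) ^ 2) =
        fun k : ℕ => 1 / ((k : ℝ) + (j + 1)) ^ 2 := by
      funext k; push_cast; ring
    have hs : ∑ i ∈ Finset.range (m + 1), 1 / (j + (i : ℝ)) =
        ∑ i ∈ Finset.range m, 1 / (j + 1 + (i : ℝ)) + 1 / j := by
      rw [Finset.sum_range_succ']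
      congr 1
      · exact Finset.sum_congr rfl fun i _ => by push_cast; ring
      · simp
    rw [altSum_succ, h, ih hj, ih (by positivity), Nat.factorial_succ, poch_succ_left j m,
      poch_succ_left j (m + 1), poch_succ (j + 1) m, Finset.sum_range_succ _ (m + 1), hs,
      Finset.sum_range_succ]
    have := poch_pos (add_pos hj one_pos) m
    have h1 : j + 1 + m ≠ 0 := by positivity
    have h2 : j + ((m + 1 : ℕ) : ℝ) = j + 1 + m := by push_cast; ring
    rw [h2]
    push_cast
    field_simp
    ring

theorem factorial_div_poch_one (m : ℕ) :
    (m.factorial : ℝ) / poch 1 (m + 1) = 1 / ((m : ℝ) + 1) := by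
  induction m with
  | zero => simp [poch]
  | succ m ih =>
    rw [Nat.factorial_succ, poch_succ, Nat.cast_mul, mul_comm, mul_div_mul_comm, ih]
    push_cast
    field_simp
    ring

theorem factorial_div_poch_two (m : ℕ) :
    (m.factorial : ℝ) / poch 2 (m + 1) = 1 / (((m : ℝ) + 1) * (m + 2)) := by
  induction m with
  | zero => simp [poch]
  | succ m ih =>
    rw [Nat.factorial_succ, poch_succ, Nat.cast_mul, mul_comm, mul_div_mul_comm, ih]
    push_cast
    field_simp
    ring

theorem factorial_div_poch_three (m : ℕ) :
    (m.factorial : ℝ) / poch 3 (m + 1) = 2 / (((m : ℝ) + 1) * (m + 2) * (m + 3)) := by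
  induction m with
  | zero => norm_num [poch]
  | succ m ih =>
    rw [Nat.factorial_succ, poch_succ, Nat.cast_mul, mul_comm, mul_div_mul_comm, ih]
    push_cast
    field_simp
    ring

theorem sum_one_div_three_add (m : ℕ) :
    ∑ i ∈ Finset.range (m + 1), 1 / (3 + (i : ℝ)) =
      ∑ k ∈ Finset.Icc 1 (m + 3), 1 / (k : ℝ) - 3 / 2 := by
  induction m with
  | zero => simp [Finset.sum_Icc_succ_top]; norm_num
  | succ m ih =>
    rw [Finset.sum_range_succ, ih, Finset.sum_Icc_succ_top (b := m + 3) (by omega)]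
    push_cast
    ring

section Moments

theorem sum_pow_mul_pow_mul_sq {A : Type*} [CommRing A] (p q : A) (M : ℕ) :
    (∑ a ∈ Finset.range M, ((M - a : ℕ) : A) * (p ^ a * q ^ (M - a - 1))) * (q - p) ^ 2 =
      (M + 1) * (q ^ M * (q - p)) - q ^ (M + 1) + p ^ (M + 1) := by
  induction M with
  | zero => simp
  | succ M ih =>
    have h : ∑ a ∈ Finset.range (M + 1), ((M + 1 - a : ℕ) : A) * (p ^ a * q ^ (M + 1 - a - 1)) =
        p * (∑ a ∈ Finset.range M, ((M - a : ℕ) : A) * (p ^ a * q ^ (M - a - 1))) +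
          (M + 1) * q ^ M := by
      rw [Finset.sum_range_succ', Finset.mul_sum]
      congr 1
      · refine Finset.sum_congr rfl fun a _ => ?_
        rw [Nat.add_sub_add_right]
        ring
      · simp
    rw [h, add_mul, mul_assoc, ih]
    push_cast
    ring

variable {A : Type*} [CommRing A] [Algebra ℝ A] (Λ : A →ₗ[ℝ] ℝ) (x y : A) {s t r : ℝ}

theorem one_sub_pow_eq_sum (z : A) (m : ℕ) :
    (1 - z) ^ m = ∑ k ∈ Finset.range (m + 1), ((-1 : ℝ) ^ k * (m.choose k : ℝ)) • z ^ k := by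
  rw [show 1 - z = -z + 1 by ring, add_pow]
  refine Finset.sum_congr rfl fun k _ => ?_
  rw [Algebra.smul_def, neg_pow]
  simp
  ring

/-- Moments of the product of the `Beta(s,t)` distribution with the measure
`(1 - y) ^ (r - 1) dy` on `[0, 1]`. -/
def HasBetaMoments (s t r : ℝ) : Prop :=
  ∀ b c : ℕ, Λ (x ^ b * y ^ c) =
    poch s b / poch (s + t) b * ((c.factorial : ℝ) / poch r (c + 1))

variable {Λ x y}

theorem HasBetaMoments.apply_one_sub (h : HasBetaMoments Λ x y s t r) (hst : 0 < s + t)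
    (a b c : ℕ) : Λ (x ^ b * (1 - x) ^ a * y ^ c) =
      poch s b * poch t a / poch (s + t) (a + b) * ((c.factorial : ℝ) / poch r (c + 1)) := by
  induction a generalizing b with
  | zero => simpa [poch_zero] using h b c
  | succ a ih =>
    have e : x ^ b * (1 - x) ^ (a + 1) * y ^ c =
        x ^ b * (1 - x) ^ a * y ^ c - x ^ (b + 1) * (1 - x) ^ a * y ^ c := by ring
    rw [e, map_sub, ih, ih, ← sub_mul, ← add_assoc a b 1, add_right_comm a 1 b,
      poch_succ (s + t), poch_succ s, poch_succ t]
    congr 1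
    have := poch_pos hst (a + b)
    have : s + t + ((a + b : ℕ) : ℝ) ≠ 0 := by positivity
    field_simp
    push_cast
    ring

theorem factorial_div_poch_sub (hr : 0 < r) (c : ℕ) :
    (c.factorial : ℝ) / poch r (c + 1) - ((c + 1).factorial : ℝ) / poch r (c + 1 + 1) =
      (c.factorial : ℝ) / poch (r + 1) (c + 1) := by
  rw [Nat.factorial_succ, poch_succ_left r (c + 1), poch_succ_left r c, poch_succ (r + 1) c]
  have := poch_pos (add_pos hr one_pos) c
  have : r + 1 + c ≠ 0 := by positivity
  push_cast
  field_simp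
  ring

theorem HasBetaMoments.apply_mul_one_sub (h : HasBetaMoments Λ x y s t r) (hst : 0 < s + t)
    (hr : 0 < r) (a b c : ℕ) : Λ (x ^ b * (1 - x) ^ a * y ^ c * (1 - y)) =
      poch s b * poch t a / poch (s + t) (a + b) *
        ((c.factorial : ℝ) / poch (r + 1) (c + 1)) := by
  have e : x ^ b * (1 - x) ^ a * y ^ c * (1 - y) =
      x ^ b * (1 - x) ^ a * y ^ c - x ^ b * (1 - x) ^ a * y ^ (c + 1) := by ring
  rw [e, map_sub, h.apply_one_sub hst, h.apply_one_sub hst, ← mul_sub, factorial_div_poch_sub hr]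

theorem HasBetaMoments.apply_mul_one_sub_sq (h : HasBetaMoments Λ x y s t r) (hst : 0 < s + t)
    (hr : 0 < r) (a b c : ℕ) : Λ (x ^ b * (1 - x) ^ a * y ^ c * (1 - y) ^ 2) =
      poch s b * poch t a / poch (s + t) (a + b) *
        ((c.factorial : ℝ) / poch (r + 2) (c + 1)) := by
  have e : x ^ b * (1 - x) ^ a * y ^ c * (1 - y) ^ 2 =
      x ^ b * (1 - x) ^ a * y ^ c * (1 - y) -
        x ^ b * (1 - x) ^ a * y ^ (c + 1) * (1 - y) := by ring
  rw [e, map_sub, h.apply_mul_one_sub hst hr, h.apply_mul_one_sub hst hr, ← mul_sub,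
    factorial_div_poch_sub (by positivity), show r + 1 + 1 = r + 2 by ring]

end Moments

theorem exists_hasBetaMoments (s t r : ℝ) :
    ∃ Λ : MvPolynomial (Fin 2) ℝ →ₗ[ℝ] ℝ,
      HasBetaMoments Λ (MvPolynomial.X 0) (MvPolynomial.X 1) s t r := by
  refine ⟨(MvPolynomial.basisMonomials (Fin 2) ℝ).constr ℝ fun d =>
    poch s (d 0) / poch (s + t) (d 0) *
      (((d 1).factorial : ℝ) / poch r (d 1 + 1)), fun b c => ?_⟩
  have e : (MvPolynomial.X 0 ^ b * MvPolynomial.X 1 ^ c : MvPolynomial (Fin 2) ℝ) =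
      MvPolynomial.basisMonomials (Fin 2) ℝ (Finsupp.single 0 b + Finsupp.single 1 c) := by
    simp [MvPolynomial.X_pow_eq_monomial, MvPolynomial.monomial_mul]
  rw [e, Module.Basis.constr_basis]
  simp

/-- The double sum reduces to two single sums and a hypergeometric term. -/
theorem sum_sum_F14 (M : ℕ) {ε : ℝ} (h1 : -1 < ε) (h2 : ε < 1) :
    ∑ j₀ ∈ Finset.range M, ∑ j₁ ∈ Finset.range (M - j₀), F14 ε (M + 2) j₀ j₁ =
      (3 + ε / 2) *
        (((M : ℝ) + 1) * altSum (fun k => poch (3 - ε / 2) k / poch (4 - ε) k *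
            ((k.factorial : ℝ) / poch (2 + ε / 2) (k + 1))) M -
          altSum (fun k => poch (3 - ε / 2) k / poch (4 - ε) k *
            ((k.factorial : ℝ) / poch (1 + ε / 2) (k + 1))) (M + 1) +
          poch (1 - ε / 2) (M + 1) / poch (4 - ε) (M + 1) *
            (((M + 1).factorial : ℝ) / poch (1 + ε / 2) (M + 1 + 1))) := by
  obtain ⟨Λ, hΛ⟩ := exists_hasBetaMoments (3 - ε / 2) (1 - ε / 2) (1 + ε / 2)
  set x : MvPolynomial (Fin 2) ℝ := MvPolynomial.X 0
  set y : MvPolynomial (Fin 2) ℝ := MvPolynomial.X 1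
  have hst : 3 - ε / 2 + (1 - ε / 2) = 4 - ε := by ring
  have hst0 : 0 < 3 - ε / 2 + (1 - ε / 2) := by linarith
  have hr0 : 0 < 1 + ε / 2 := by linarith
  have key := congrArg Λ (sum_pow_mul_pow_mul_sq ((1 - x) * y) (1 - x * y) M)
  have hq : 1 - x * y - (1 - x) * y = 1 - y := by ring
  rw [hq, Finset.sum_mul, map_sum, map_add, map_sub] at key
  have hA : Λ (((M : MvPolynomial (Fin 2) ℝ) + 1) * ((1 - x * y) ^ M * (1 - y))) =
      ((M : ℝ) + 1) * altSum (fun k => poch (3 - ε / 2) k / poch (4 - ε) k *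
            ((k.factorial : ℝ) / poch (2 + ε / 2) (k + 1))) M := by
    have e : ((M : MvPolynomial (Fin 2) ℝ) + 1) * ((1 - x * y) ^ M * (1 - y)) =
        ((M : ℝ) + 1) • ((1 - x * y) ^ M * (1 - y)) := by
      rw [Algebra.smul_def]; simp
    rw [e, map_smul, one_sub_pow_eq_sum, Finset.sum_mul, map_sum, smul_eq_mul, altSum]
    congr 1
    refine Finset.sum_congr rfl fun k _ => ?_
    have := hΛ.apply_mul_one_sub hst0 hr0 0 k k
    rw [smul_mul_assoc, map_smul, smul_eq_mul, mul_pow]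
    rw [pow_zero, mul_one, hst, zero_add, poch_zero, mul_one,
      show 1 + ε / 2 + 1 = 2 + ε / 2 by ring] at this
    rw [this]
  have hB : Λ ((1 - x * y) ^ (M + 1)) =
      altSum (fun k => poch (3 - ε / 2) k / poch (4 - ε) k *
            ((k.factorial : ℝ) / poch (1 + ε / 2) (k + 1))) (M + 1) := by
    rw [one_sub_pow_eq_sum, map_sum, altSum]
    refine Finset.sum_congr rfl fun k _ => ?_
    rw [map_smul, smul_eq_mul, mul_pow, hΛ k k, hst]
  have hC : Λ (((1 - x) * y) ^ (M + 1)) = poch (1 - ε / 2) (M + 1) / poch (4 - ε) (M + 1) *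
            (((M + 1).factorial : ℝ) / poch (1 + ε / 2) (M + 1 + 1)) := by
    have := hΛ.apply_one_sub hst0 (M + 1) 0 (M + 1)
    rw [pow_zero, one_mul, hst, add_zero, poch_zero, one_mul] at this
    rw [mul_pow, this]
  rw [hA, hB, hC] at key
  rw [← key, Finset.mul_sum]
  refine Finset.sum_congr rfl fun a ha => ?_
  obtain ⟨n, hn⟩ : ∃ n, M - a = n + 1 :=
    ⟨M - a - 1, by have := Finset.mem_range.mp ha; omega⟩
  have e : ((M - a : ℕ) : MvPolynomial (Fin 2) ℝ) *
        (((1 - x) * y) ^ a * (1 - x * y) ^ (M - a - 1)) * (1 - y) ^ 2 =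
      ∑ b ∈ Finset.range (n + 1), (((n : ℝ) + 1) * ((-1 : ℝ) ^ b * (n.choose b : ℝ))) •
        (x ^ b * (1 - x) ^ a * y ^ (a + b) * (1 - y) ^ 2) := by
    rw [hn, Nat.add_sub_cancel, one_sub_pow_eq_sum, Finset.mul_sum, Finset.mul_sum,
      Finset.sum_mul, mul_pow (1 - x)]
    refine Finset.sum_congr rfl fun b _ => ?_
    simp only [Algebra.smul_def, map_mul, map_add, map_natCast, map_one]
    push_cast
    ring
  rw [e, map_sum, hn, Finset.mul_sum]
  refine Finset.sum_congr rfl fun b _ => ?_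
  have hc : ((n : ℝ) + 1) * (n.choose b : ℝ) = ((n + 1).choose (b + 1) : ℝ) * (b + 1) := by
    exact_mod_cast Nat.add_one_mul_choose_eq n b
  rw [map_smul, hΛ.apply_mul_one_sub_sq hst0 hr0, hst, F14, Nat.add_sub_cancel, hn,
    show 1 + ε / 2 + 2 = 3 + ε / 2 by ring, poch_succ_left,
    show 3 + ε / 2 + 1 = ε / 2 + 4 by ring, smul_eq_mul]
  have p1 := poch_pos (show 0 < 4 - ε by linarith) (a + b)
  have p2 := poch_pos (show 0 < ε / 2 + 4 by linarith) (a + b)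
  have p3 : 3 + ε / 2 ≠ 0 := by linarith
  generalize poch (1 - ε / 2) a = P at *
  generalize poch (3 - ε / 2) b = Q at *
  generalize poch (4 - ε) (a + b) = R at *
  generalize poch (ε / 2 + 4) (a + b) = T at *
  generalize 3 + ε / 2 = w at *
  field_simp
  linear_combination (-(P * Q)) * hc

theorem hasDerivAt_poch_ratio {s r : ℝ} (hs : 0 < s) (hr : 0 < r) {v l : ℕ → ℝ}
    (hv0 : v 0 = 1 / r) (hl0 : l 0 = -1 / (2 * r))
    (hv : ∀ k : ℕ, v (k + 1) = v k * ((s + k) / (4 + k) * ((k + 1) / (r + (k + 1)))))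
    (hl : ∀ k : ℕ, l (k + 1) =
      l k - 1 / (2 * (s + k)) + 1 / (4 + k) - 1 / (2 * (r + (k + 1)))) (k : ℕ) :
    poch (s - 0 / 2) k / poch (4 - 0) k * ((k.factorial : ℝ) / poch (r + 0 / 2) (k + 1)) = v k ∧
    HasDerivAt (fun ε : ℝ => poch (s - ε / 2) k / poch (4 - ε) k *
      ((k.factorial : ℝ) / poch (r + ε / 2) (k + 1))) (v k * l k) 0 := by
  have hlin (c : ℝ) : HasDerivAt (fun ε : ℝ => c + ε / 2) (1 / 2) 0 :=
    ((hasDerivAt_id (0 : ℝ)).div_const 2).const_add c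
  have hlin' (c : ℝ) : HasDerivAt (fun ε : ℝ => c - ε / 2) (-(1 / 2)) 0 :=
    ((hasDerivAt_id (0 : ℝ)).div_const 2).const_sub c
  induction k with
  | zero =>
    refine ⟨by simp [poch, hv0], ?_⟩
    have := (hlin r).fun_inv (by simpa using hr.ne')
    simp only [poch, Finset.prod_range_succ, Finset.prod_range_zero, Nat.factorial_zero,
      Nat.cast_zero, Nat.cast_one, add_zero, one_mul, div_one, one_div]
    refine this.congr_deriv ?_
    rw [hv0, hl0]
    field_simp
    ring
  | succ k ih =>
    obtain ⟨ih0, ih1⟩ := ih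
    have hstep (ε : ℝ) : poch (s - ε / 2) (k + 1) / poch (4 - ε) (k + 1) *
        (((k + 1).factorial : ℝ) / poch (r + ε / 2) (k + 1 + 1)) =
        poch (s - ε / 2) k / poch (4 - ε) k * ((k.factorial : ℝ) / poch (r + ε / 2) (k + 1)) *
          ((s - ε / 2 + k) / (4 - ε + k) * ((k + 1) / (r + ε / 2 + (k + 1)))) := by
      rw [poch_succ (s - ε / 2), poch_succ (4 - ε), poch_succ (r + ε / 2) (k + 1),
        Nat.factorial_succ, mul_div_mul_comm, Nat.cast_mul, mul_comm ((k + 1 : ℕ) : ℝ),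
        mul_div_mul_comm]
      push_cast
      ring
    have h1 : s + (k : ℝ) ≠ 0 := by positivity
    have h2 : (4 : ℝ) + k ≠ 0 := by positivity
    have h3 : r + ((k : ℝ) + 1) ≠ 0 := by positivity
    refine ⟨by rw [hstep, ih0, hv]; simp, ?_⟩
    have hratio := (((hlin' s).add_const (k : ℝ)).fun_div
      (((hasDerivAt_id (0 : ℝ)).const_sub 4).add_const (k : ℝ)) (by simpa using h2)).fun_mul
      ((hasDerivAt_const (0 : ℝ) ((k : ℝ) + 1)).fun_div ((hlin r).add_const ((k : ℝ) + 1))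
        (by simpa using h3))
    have h := ih1.fun_mul hratio
    simp only [hstep]
    refine h.congr_deriv ?_
    rw [ih0, hv, hl]
    simp only [id, zero_div, sub_zero, add_zero]
    field_simp
    ring

theorem hasDerivAt_altSum {f : ℝ → ℕ → ℝ} {d : ℕ → ℝ}
    (h : ∀ k, HasDerivAt (fun ε => f ε k) (d k) 0) (m : ℕ) :
    HasDerivAt (fun ε => altSum (f ε) m) (altSum d m) 0 :=
  HasDerivAt.fun_sum fun k _ => (h k).const_mul _

theorem altSum_partial_fractions (m : ℕ) (a b c d : ℝ) :
    altSum (fun k => a * (1 / ((k : ℝ) + 1)) + b * (1 / ((k : ℝ) + 2)) +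
        c * (1 / ((k : ℝ) + 3)) + d * (1 / ((k : ℝ) + 3) ^ 2)) m =
      a / (m + 1) + b / ((m + 1) * (m + 2)) + 2 * c / ((m + 1) * (m + 2) * (m + 3)) +
        2 * d / ((m + 1) * (m + 2) * (m + 3)) *
          (∑ k ∈ Finset.Icc 1 (m + 3), 1 / (k : ℝ) - 3 / 2) := by
  simp only [altSum_add, altSum_const_mul]
  rw [altSum_one_div m one_pos, altSum_one_div m two_pos, altSum_one_div m three_pos,
    altSum_one_div_sq m three_pos, factorial_div_poch_one, factorial_div_poch_two,
    factorial_div_poch_three, sum_one_div_three_add]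
  ring

/-- The linear coefficient of the ε-expansion of the double sum (Ex-75), as the
derivative at `ε = 0`. -/
theorem stmt_16 (N : ℕ) (hN : 3 ≤ N) :
    HasDerivAt
      (fun ε : ℝ =>
        ∑ j₀ ∈ Finset.range (N - 2), ∑ j₁ ∈ Finset.range (N - 2 - j₀), F14 ε N j₀ j₁)
      (3 * ((N : ℝ) ^ 4 - 13 * (N : ℝ) ^ 3 - 28 * (N : ℝ) ^ 2 - 32 * (N : ℝ) + 24) /
          (8 * (N : ℝ) ^ 3 * ((N : ℝ) + 2)) +
        9 * ((N : ℝ) + 3) * (∑ k ∈ Finset.Icc 1 N, 1 / (k : ℝ)) /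
          ((N : ℝ) * ((N : ℝ) + 1) * ((N : ℝ) + 2))) 0 := by
  obtain ⟨M, rfl⟩ : ∃ M, N = M + 2 := ⟨N - 2, by omega⟩
  rw [Nat.add_sub_cancel]
  have hh := hasDerivAt_poch_ratio (s := 3) (r := 2) three_pos two_pos
    (v := fun k => 3 / (((k : ℝ) + 1) * (k + 2) * (k + 3)))
    (l := fun k => 1 / ((k : ℝ) + 3) - 7 / 12) (by norm_num) (by norm_num)
    (fun k => by push_cast; field_simp; ring) (fun k => by push_cast; field_simp; ring)
  have hg := hasDerivAt_poch_ratio (s := 3) (r := 1) three_pos one_pos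
    (v := fun k => 3 / (((k : ℝ) + 1) * (k + 3)))
    (l := fun k => 1 / (2 * ((k : ℝ) + 2)) + 1 / ((k : ℝ) + 3) - 13 / 12)
    (by norm_num) (by norm_num)
    (fun k => by push_cast; field_simp; ring) (fun k => by push_cast; field_simp; ring)
  have hw := hasDerivAt_poch_ratio (s := 1) (r := 1) one_pos one_pos
    (v := fun k => 6 / (((k : ℝ) + 1) ^ 2 * (k + 2) * (k + 3)))
    (l := fun k => 1 / (2 * ((k : ℝ) + 1)) + 1 / ((k : ℝ) + 2) + 1 / ((k : ℝ) + 3) - 11 / 6)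
    (by norm_num) (by norm_num)
    (fun k => by push_cast; field_simp; ring) (fun k => by push_cast; field_simp; ring)
  have hS := ((((hasDerivAt_id (0 : ℝ)).div_const 2).const_add 3).fun_mul
    ((((hasDerivAt_altSum (fun k => (hh k).2) M).const_mul ((M : ℝ) + 1)).fun_sub
      (hasDerivAt_altSum (fun k => (hg k).2) (M + 1))).fun_add (hw (M + 1)).2))
  refine (hS.congr_of_eventuallyEq ?_).congr_deriv ?_
  · filter_upwards [Ioo_mem_nhds (show (-1 : ℝ) < 0 by norm_num) one_pos] with ε hε
    exact sum_sum_F14 M hε.1 hε.2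
  · simp only [(hh _).1, (hg _).1, (hw _).1, id]
    have e1 : (fun k : ℕ => 3 / (((k : ℝ) + 1) * (k + 2) * (k + 3))) =
        fun k : ℕ => 3 / 2 * (1 / ((k : ℝ) + 1)) + -3 * (1 / ((k : ℝ) + 2)) +
          3 / 2 * (1 / ((k : ℝ) + 3)) + 0 * (1 / ((k : ℝ) + 3) ^ 2) := by
      funext k; field_simp; ring
    have e2 : (fun k : ℕ => 3 / (((k : ℝ) + 1) * (k + 2) * (k + 3)) *
        (1 / ((k : ℝ) + 3) - 7 / 12)) =
        fun k : ℕ => -1 / 8 * (1 / ((k : ℝ) + 1)) + -5 / 4 * (1 / ((k : ℝ) + 2)) +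
          11 / 8 * (1 / ((k : ℝ) + 3)) + 3 / 2 * (1 / ((k : ℝ) + 3) ^ 2) := by
      funext k; field_simp; ring
    have e3 : (fun k : ℕ => 3 / (((k : ℝ) + 1) * (k + 3))) =
        fun k : ℕ => 3 / 2 * (1 / ((k : ℝ) + 1)) + 0 * (1 / ((k : ℝ) + 2)) +
          -3 / 2 * (1 / ((k : ℝ) + 3)) + 0 * (1 / ((k : ℝ) + 3) ^ 2) := by
      funext k; field_simp; ring
    have e4 : (fun k : ℕ => 3 / (((k : ℝ) + 1) * (k + 3)) *
        (1 / (2 * ((k : ℝ) + 2)) + 1 / ((k : ℝ) + 3) - 13 / 12)) =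
        fun k : ℕ => -1 / 8 * (1 / ((k : ℝ) + 1)) + -3 / 2 * (1 / ((k : ℝ) + 2)) +
          13 / 8 * (1 / ((k : ℝ) + 3)) + -3 / 2 * (1 / ((k : ℝ) + 3) ^ 2) := by
      funext k; field_simp; ring
    rw [e1, e2, e3, e4]
    simp only [altSum_partial_fractions]
    rw [Finset.sum_Icc_succ_top (b := M + 3) (by omega),
      Finset.sum_Icc_succ_top (b := M + 2) (by omega)]
    push_cast
    field_simp
    ring
end

section
/- For every integer N ≥ 3 the following identity holds in ℚ: Σ_{j₀=0}^{N−3} Σ_{j₁=0}^{N−j₀−3} Σ_{j₂=0}^{j₀+1} 3·(−1)^N·C(j₀+1, j₂)·C(N−j₀−3, j₁)·(j₁+j₂+1)!·(j₁+j₂+2)!·(j₁+2)!·(N−j₀−2)!·(N−j₁−j₂−2)! / (N!·(j₁+j₂+3)!·(j₁+3)!·(N−j₀−3)!) = 3(−1)^N(N²+2N−1)·S_1(N)/(N(N+1)) − 9(−1)^N + 6(−1)^N·S_2(N)/N, where C(n,k) is the binomial coefficient, S_1(N) = Σ_{k=1}^{N} 1/k and S_2(N) = Σ_{k=1}^{N}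 1/k². -/
open Finset in
/-- The dual Vandermonde convolution: summation over the upper indices. -/
theorem sum_antidiagonal_choose_mul_choose (n c d : ℕ) :
    ∑ ij ∈ antidiagonal n, ij.1.choose c * ij.2.choose d = (n + 1).choose (c + d + 1) := by
  induction n generalizing d with
  | zero => rcases c with _ | c <;> rcases d with _ | d <;> simp [Nat.choose_eq_zero_of_lt]
  | succ n ih =>
    rw [Finset.Nat.sum_antidiagonal_succ']
    rcases d with _ | d
    · have h := ih 0
      simp only [Nat.choose_zero_right, mul_one, add_zero] at h ⊢
      rw [h, Nat.choose_succ_succ (n + 1) c]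
    · simp only [Nat.choose_succ_succ _ d, mul_add, sum_add_distrib, ih, Nat.choose_zero_succ,
        mul_zero, zero_add]
      rw [← add_assoc c d 1, Nat.choose_succ_succ (n + 1) (c + d + 1)]

/-- The convolution `∑ₐ C(a+1, c) C(m-a, b) (m+1-a)`, in closed form. -/
theorem sum_range_choose_mul_choose_mul (m b c : ℕ) :
    ∑ a ∈ Finset.range (m + 1),
        ((a + 1).choose c : ℚ) * ((m - a).choose b : ℚ) * ((m - a + 1 : ℕ) : ℚ) =
      ((b : ℚ) + 1) *
        (((m + 3).choose (b + c + 2) : ℚ) - (if c = 0 then ((m + 2).choose (b + 1) : ℚ) else 0)) := by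
  have h := sum_antidiagonal_choose_mul_choose (m + 2) c (b + 1)
  rw [Finset.Nat.sum_antidiagonal_eq_sum_range_succ (fun i j => i.choose c * j.choose (b + 1)),
    Finset.sum_range_succ', Finset.sum_range_succ] at h
  have h' : ∑ a ∈ Finset.range (m + 1), (a + 1).choose c * (m - a + 1).choose (b + 1) +
      (if c = 0 then (m + 2).choose (b + 1) else 0) = (m + 3).choose (b + c + 2) := by
    rw [show b + c + 2 = c + (b + 1) + 1 by ring, ← h]
    congr 1
    · simp only [Nat.sub_self, Nat.choose_zero_succ, mul_zero, add_zero]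
      refine Finset.sum_congr rfl fun a ha => ?_
      have := Finset.mem_range.mp ha
      rw [show m + 2 - (a + 1) = m - a + 1 by omega]
    · rcases c with _ | c <;> simp
  have hq : ((m + 3).choose (b + c + 2) : ℚ) = _ := congrArg (Nat.cast (R := ℚ)) h'.symm
  rw [hq]
  push_cast
  rw [add_sub_cancel_right, Finset.mul_sum]
  refine Finset.sum_congr rfl fun a _ => ?_
  have := congrArg (Nat.cast (R := ℚ)) (Nat.add_one_mul_choose_eq (m - a) b)
  push_cast at this
  linear_combination ((a + 1).choose c : ℚ) * this

/-- Extending a double sum weighted by binomials to the full triangle. -/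
theorem sum_range_choose_extend (m a : ℕ) (ha : a ≤ m) (w : ℕ → ℕ → ℚ) :
    ∑ b ∈ Finset.range (m - a + 1), ∑ c ∈ Finset.range (a + 2),
        ((a + 1).choose c : ℚ) * ((m - a).choose b : ℚ) * w b c =
      ∑ b ∈ Finset.range (m + 2), ∑ c ∈ Finset.range (m + 2 - b),
        ((a + 1).choose c : ℚ) * ((m - a).choose b : ℚ) * w b c := by
  have hsub : Finset.range (m - a + 1) ⊆ Finset.range (m + 2) :=
    Finset.range_subset_range.mpr (by omega)
  rw [← Finset.sum_subset hsub]
  · refine Finset.sum_congr rfl fun b hb => ?_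
    rw [Finset.mem_range] at hb
    refine Finset.sum_subset (Finset.range_subset_range.mpr (by omega)) fun c _ hc => ?_
    rw [Finset.mem_range] at hc
    rw [Nat.choose_eq_zero_of_lt (by omega : a + 1 < c)]
    simp
  · intro b _ hb
    rw [Finset.mem_range] at hb
    rw [Nat.choose_eq_zero_of_lt (by omega : m - a < b)]
    simp

theorem sum_range_add_one_div_add_three (n : ℕ) :
    ∑ b ∈ Finset.range n, ((b : ℚ) + 1) / ((b : ℚ) + 3) =
      (n : ℚ) + 3 - 2 * ∑ k ∈ Finset.Icc 1 (n + 2), 1 / (k : ℚ) := by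
  induction n with
  | zero => norm_num [Finset.sum_Icc_succ_top]
  | succ n ih =>
    rw [Finset.sum_range_succ, ih, Finset.sum_Icc_succ_top (by omega : 1 ≤ n + 2 + 1)]
    push_cast
    field_simp
    ring

theorem sum_range_add_one_div_add_three_sq (n : ℕ) :
    ∑ b ∈ Finset.range n, ((b : ℚ) + 1) / ((b : ℚ) + 3) ^ 2 =
      ∑ k ∈ Finset.Icc 1 (n + 2), 1 / (k : ℚ) - 2 * ∑ k ∈ Finset.Icc 1 (n + 2), 1 / (k : ℚ) ^ 2
        + 1 := by
  induction n with
  | zero => norm_num [Finset.sum_Icc_succ_top]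
  | succ n ih =>
    rw [Finset.sum_range_succ, ih, Finset.sum_Icc_succ_top (by omega : 1 ≤ n + 2 + 1),
      Finset.sum_Icc_succ_top (by omega : 1 ≤ n + 2 + 1)]
    push_cast
    field_simp
    ring

theorem sum_range_sum_range_add_one_div_add_three (n : ℕ) :
    ∑ p ∈ Finset.range n, ∑ b ∈ Finset.range (p + 1),
        ((b : ℚ) + 1) / ((b : ℚ) + 3) / (((p : ℚ) + 2) * ((p : ℚ) + 3)) =
      ((n : ℚ) + 4) / ((n : ℚ) + 2) * ∑ k ∈ Finset.Icc 1 (n + 2), 1 / (k : ℚ) - 3 := by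
  induction n with
  | zero => norm_num [Finset.sum_Icc_succ_top]
  | succ n ih =>
    rw [Finset.sum_range_succ, ih, ← Finset.sum_div, sum_range_add_one_div_add_three,
      show n + 1 + 2 = n + 2 + 1 by ring, Finset.sum_Icc_succ_top (by omega : 1 ≤ n + 2 + 1)]
    push_cast
    field_simp
    ring

/-- The factor multiplying the binomials depends only on the two inner summation indices. -/
noncomputable def tripleSumWeight (m b c : ℕ) : ℚ :=
  ((b + c + 1).factorial : ℚ) * ((m + 1 - b - c).factorial : ℚ) /
    (((m + 3).factorial : ℚ) * ((b : ℚ) + c + 3) * ((b : ℚ) + 3))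

theorem tripleSumWeight_mul_eq (m b c : ℕ) (h : b + c ≤ m + 1) :
    tripleSumWeight m b c * (((b : ℚ) + 1) *
        (((m + 3).choose (b + c + 2) : ℚ) - (if c = 0 then ((m + 2).choose (b + 1) : ℚ) else 0))) =
      ((b : ℚ) + 1) / ((b : ℚ) + 3) / (((b : ℚ) + c + 2) * ((b : ℚ) + c + 3)) -
        (if c = 0 then ((b : ℚ) + 1) / ((b : ℚ) + 3) ^ 2 / ((m : ℚ) + 3) else 0) := by
  obtain ⟨r, hr⟩ := Nat.exists_eq_add_of_le h
  have h1 : ((m + 3).choose (b + c + 2) : ℚ) * (b + c + 2).factorial * r.factorial =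
      (m + 3).factorial := by
    have := Nat.choose_mul_factorial_mul_factorial (by omega : b + c + 2 ≤ m + 3)
    rw [show m + 3 - (b + c + 2) = r by omega] at this
    exact_mod_cast this
  have hr' : m + 1 - b - c = r := by omega
  have hf : ((m + 3).factorial : ℚ) ≠ 0 := by positivity
  have hA : tripleSumWeight m b c * ((m + 3).choose (b + c + 2) : ℚ) =
      1 / (((b : ℚ) + c + 2) * ((b : ℚ) + c + 3) * ((b : ℚ) + 3)) := by
    rw [Nat.factorial_succ (b + c + 1)] at h1
    push_cast at h1
    rw [tripleSumWeight, hr']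
    field_simp
    linear_combination h1
  rcases c with _ | c
  · have h2 : ((m + 2).choose (b + 1) : ℚ) * (b + 1).factorial * r.factorial =
        (m + 2).factorial := by
      have := Nat.choose_mul_factorial_mul_factorial (by omega : b + 1 ≤ m + 2)
      rw [show m + 2 - (b + 1) = r by omega] at this
      exact_mod_cast this
    have hB : tripleSumWeight m b 0 * ((m + 2).choose (b + 1) : ℚ) =
        1 / (((b : ℚ) + 3) ^ 2 * ((m : ℚ) + 3)) := by
      rw [tripleSumWeight, hr', Nat.factorial_succ (m + 2), add_zero]
      have hg : ((m + 2).factorial : ℚ) ≠ 0 := by positivity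
      push_cast
      rw [← h2] at hg ⊢
      have h3 : (m : ℚ) + 2 + 1 ≠ 0 := by positivity
      have h4 := left_ne_zero_of_mul (left_ne_zero_of_mul hg)
      field_simp
      ring
    simp only [if_true]
    linear_combination (norm := skip) ((b : ℚ) + 1) * hA - ((b : ℚ) + 1) * hB
    push_cast
    field_simp
    ring
  · simp only [Nat.succ_ne_zero, if_false, sub_zero]
    linear_combination (norm := skip) ((b : ℚ) + 1) * hA
    push_cast
    field_simp
    ring

/-- The unsigned triple sum as a difference of a nested and a single harmonic-type sum. -/
theorem sum_choose_mul_tripleSumWeight (m : ℕ) :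
    ∑ a ∈ Finset.range (m + 1), ∑ b ∈ Finset.range (m - a + 1), ∑ c ∈ Finset.range (a + 2),
        ((a + 1).choose c : ℚ) * ((m - a).choose b : ℚ) *
          (((m - a + 1 : ℕ) : ℚ) * tripleSumWeight m b c) =
      ∑ p ∈ Finset.range (m + 2), ∑ b ∈ Finset.range (p + 1),
          ((b : ℚ) + 1) / ((b : ℚ) + 3) / (((p : ℚ) + 2) * ((p : ℚ) + 3)) -
        (∑ b ∈ Finset.range (m + 2), ((b : ℚ) + 1) / ((b : ℚ) + 3) ^ 2) / ((m : ℚ) + 3) := by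
  have hdiag := Finset.sum_range_diag_flip (m + 2) (fun b c : ℕ =>
    ((b : ℚ) + 1) / ((b : ℚ) + 3) / (((b : ℚ) + c + 2) * ((b : ℚ) + c + 3)))
  have hdiag' : ∑ p ∈ Finset.range (m + 2), ∑ b ∈ Finset.range (p + 1),
      ((b : ℚ) + 1) / ((b : ℚ) + 3) / (((p : ℚ) + 2) * ((p : ℚ) + 3)) = _ :=
    Eq.trans (Finset.sum_congr rfl fun p _ => Finset.sum_congr rfl fun b hb => by
      rw [Nat.cast_sub (Nat.lt_succ_iff.mp (Finset.mem_range.mp hb)), add_sub_cancel]) hdiag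
  rw [hdiag', Finset.sum_div, ← Finset.sum_sub_distrib]
  rw [Finset.sum_congr rfl fun a ha => sum_range_choose_extend m a
    (Nat.lt_succ_iff.mp (Finset.mem_range.mp ha))
    (fun b c => ((m - a + 1 : ℕ) : ℚ) * tripleSumWeight m b c), Finset.sum_comm]
  refine Finset.sum_congr rfl fun b hb => ?_
  rw [Finset.mem_range] at hb
  have hsingle : ((b : ℚ) + 1) / ((b : ℚ) + 3) ^ 2 / ((m : ℚ) + 3) =
      ∑ c ∈ Finset.range (m + 2 - b),
        if c = 0 then ((b : ℚ) + 1) / ((b : ℚ) + 3) ^ 2 / ((m : ℚ) + 3) else 0 := by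
    rw [Finset.sum_ite_eq' (Finset.range (m + 2 - b)) 0
      (fun _ => ((b : ℚ) + 1) / ((b : ℚ) + 3) ^ 2 / ((m : ℚ) + 3)),
      if_pos (Finset.mem_range.mpr (by omega))]
  rw [hsingle, ← Finset.sum_sub_distrib, Finset.sum_comm]
  refine Finset.sum_congr rfl fun c hc => ?_
  rw [Finset.mem_range] at hc
  rw [← tripleSumWeight_mul_eq m b c (by omega), ← sum_range_choose_mul_choose_mul,
    Finset.mul_sum]
  exact Finset.sum_congr rfl fun a _ => by ring

/-- The constant term of the ε-expansion of the multi-sum (Ex-857): at `ε = 0` only the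
`σ₁ = 0` term of the infinite sum survives and the remaining triple finite sum is given
in factorial form; it equals a combination of the harmonic sums `S₁(N)` and `S₂(N)`. -/
theorem stmt_17 (N : ℕ) (hN : 3 ≤ N) :
    ∑ j₀ ∈ Finset.range (N - 2), ∑ j₁ ∈ Finset.range (N - j₀ - 2),
        ∑ j₂ ∈ Finset.range (j₀ + 2),
          3 * (-1 : ℚ) ^ N * ((j₀ + 1).choose j₂ : ℚ) * ((N - j₀ - 3).choose j₁ : ℚ) *
              ((j₁ + j₂ + 1).factorial : ℚ) * ((j₁ + j₂ + 2).factorial : ℚ) *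
              ((j₁ + 2).factorial : ℚ) * ((N - j₀ - 2).factorial : ℚ) *
              ((N - j₁ - j₂ - 2).factorial : ℚ) /
            ((N.factorial : ℚ) * ((j₁ + j₂ + 3).factorial : ℚ) *
              ((j₁ + 3).factorial : ℚ) * ((N - j₀ - 3).factorial : ℚ)) =
      3 * (-1 : ℚ) ^ N * ((N : ℚ) ^ 2 + 2 * (N : ℚ) - 1) *
          (∑ k ∈ Finset.Icc 1 N, 1 / (k : ℚ)) / ((N : ℚ) * ((N : ℚ) + 1)) -
        9 * (-1 : ℚ) ^ N +
        6 * (-1 : ℚ) ^ N * (∑ k ∈ Finset.Icc 1 N, 1 / (k : ℚ) ^ 2) / (N : ℚ) := by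
  obtain ⟨m, rfl⟩ := Nat.exists_eq_add_of_le' hN
  have key := sum_choose_mul_tripleSumWeight m
  rw [sum_range_sum_range_add_one_div_add_three, sum_range_add_one_div_add_three_sq,
    show m + 2 + 2 = m + 3 + 1 by ring, Finset.sum_Icc_succ_top (by omega : 1 ≤ m + 3 + 1),
    Finset.sum_Icc_succ_top (by omega : 1 ≤ m + 3 + 1)] at key
  trans 3 * (-1 : ℚ) ^ (m + 3) * ∑ a ∈ Finset.range (m + 1), ∑ b ∈ Finset.range (m - a + 1),
      ∑ c ∈ Finset.range (a + 2), ((a + 1).choose c : ℚ) * ((m - a).choose b : ℚ) *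
        (((m - a + 1 : ℕ) : ℚ) * tripleSumWeight m b c)
  · simp only [Finset.mul_sum]
    refine Finset.sum_congr rfl fun a ha => ?_
    rw [Finset.mem_range] at ha
    rw [show m + 3 - a - 2 = m - a + 1 by omega, show m + 3 - a - 3 = m - a by omega]
    refine Finset.sum_congr rfl fun b _ => Finset.sum_congr rfl fun c _ => ?_
    rw [tripleSumWeight, show m + 3 - b - c - 2 = m + 1 - b - c by omega,
      Nat.factorial_succ (b + c + 2), Nat.factorial_succ (b + 2), Nat.factorial_succ (m - a)]
    have h1 : ((b + c + 2).factorial : ℚ) ≠ 0 := by positivity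
    have h2 : ((b + 2).factorial : ℚ) ≠ 0 := by positivity
    have h3 : ((m - a).factorial : ℚ) ≠ 0 := by positivity
    have h4 : ((m + 3).factorial : ℚ) ≠ 0 := by positivity
    rw [Nat.cast_mul, Nat.cast_mul, Nat.cast_mul,
      show ((b + c + 2 + 1 : ℕ) : ℚ) = (b : ℚ) + c + 3 by push_cast; ring,
      show ((b + 2 + 1 : ℕ) : ℚ) = (b : ℚ) + 3 by push_cast; ring]
    field_simp
  · rw [key]
    push_cast
    field_simp
    ring
end

section
/- For x ∈ ℝ and k ∈ ℕ let (x)_k = ∏_{i=0}^{k−1}(x+i) denote the Pochhammer symbol. Fix a real number ε with 0 < ε < 1 and natural numbers j₁, j₂. Then the function t : ℕ → ℝ given by t(σ) = (ε/2+1)_σ·(−ε)_σ·(j₁+j₂+3)_σ / ((j₁+4)_σ·(j₁+j₂+4−ε/2)_σ·σ!) satisfies t(σ) = O(σ^{−5}) as σ → ∞; that is, there is a constant C > 0 such that |t(σ)| ≤ C·σ^{−5} for all σ ≥ 1. -/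
open Filter Topology in
/-- The Gauss product formula for `Γ`, as the growth rate of the Pochhammer symbol:
`(a)_n ∼ n! n^(a-1) / Γ(a)`. -/
theorem tendsto_poch_div_factorial_mul_rpow (a : ℝ) (ha : ∀ m : ℕ, a ≠ -m) :
    Tendsto (fun n : ℕ => poch a n / ((n.factorial : ℝ) * (n : ℝ) ^ (a - 1))) atTop
      (𝓝 (Real.Gamma a)⁻¹) := by
  have hratio : Tendsto (fun n : ℕ => (n : ℝ) / (n + a)) atTop (𝓝 1) :=
    tendsto_natCast_div_add_atTop a
  have hGamma := (Real.GammaSeq_tendsto_Gamma a).inv₀ (Real.Gamma_ne_zero ha)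
  have hprod := hratio.mul hGamma
  rw [one_mul] at hprod
  refine hprod.congr' ?_
  filter_upwards [eventually_ge_atTop 1] with n hn
  have hn0 : (0 : ℝ) < n := by exact_mod_cast hn
  have hna : (n : ℝ) + a ≠ 0 := fun h => ha n (by linarith)
  have hfac : (n.factorial : ℝ) ≠ 0 := by positivity
  have hpow : (n : ℝ) ^ a ≠ 0 := by positivity
  rw [Real.GammaSeq, Finset.prod_range_succ, Real.rpow_sub_one hn0.ne', poch, add_comm a (n : ℝ)]
  field_simp

/-- The asymptotic bound (condition (4), formula (limitconsiderations)) for the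
`σ₁`-dependent part of the summand of the multi-sum (Ex-857): the term behaves like
`O(σ^{-5})` as `σ → ∞`. -/
theorem stmt_18 (ε : ℝ) (hε0 : 0 < ε) (hε1 : ε < 1) (j₁ j₂ : ℕ) :
    ∃ C : ℝ, 0 < C ∧ ∀ σ : ℕ, 1 ≤ σ →
      |poch (ε / 2 + 1) σ * poch (-ε) σ * poch ((j₁ : ℝ) + (j₂ : ℝ) + 3) σ /
          (poch ((j₁ : ℝ) + 4) σ * poch ((j₁ : ℝ) + (j₂ : ℝ) + 4 - ε / 2) σ *
            (σ.factorial : ℝ))| ≤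
        C * (σ : ℝ) ^ (-5 : ℤ) := by
  have hj₁ : (0 : ℝ) ≤ j₁ := j₁.cast_nonneg
  have hj₂ : (0 : ℝ) ≤ j₂ := j₂.cast_nonneg
  have ne_of_pos : ∀ a : ℝ, 0 < a → ∀ m : ℕ, a ≠ -m := fun a ha m h => by
    have := m.cast_nonneg (α := ℝ)
    linarith
  have neg_ε_ne : ∀ m : ℕ, -ε ≠ -m := fun m h => by
    have h' : ε = m := by linarith
    rw [h'] at hε0 hε1
    norm_cast at hε0 hε1
    lia
  have ha₁ := ne_of_pos (ε / 2 + 1) (by linarith)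
  have ha₃ := ne_of_pos ((j₁ : ℝ) + j₂ + 3) (by linarith)
  have hb₁ := ne_of_pos ((j₁ : ℝ) + 4) (by linarith)
  have hb₂ := ne_of_pos ((j₁ : ℝ) + j₂ + 4 - ε / 2) (by linarith)
  have hlim := (((tendsto_poch_div_factorial_mul_rpow _ ha₁).mul
    (tendsto_poch_div_factorial_mul_rpow _ neg_ε_ne)).mul
    (tendsto_poch_div_factorial_mul_rpow _ ha₃)).div
    ((tendsto_poch_div_factorial_mul_rpow _ hb₁).mul
    (tendsto_poch_div_factorial_mul_rpow _ hb₂))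
    (mul_ne_zero (inv_ne_zero (Real.Gamma_ne_zero hb₁)) (inv_ne_zero (Real.Gamma_ne_zero hb₂)))
  obtain ⟨C, hC0, hC⟩ := (Metric.isBounded_range_of_tendsto _ hlim).exists_pos_norm_le
  refine ⟨C, hC0, fun σ hσ => ?_⟩
  have hσ1 : (1 : ℝ) ≤ σ := by exact_mod_cast hσ
  have hσ0 : (0 : ℝ) < σ := by linarith
  have hbound := hC _ ⟨σ, rfl⟩
  have hexp : (σ : ℝ) ^ ((j₁ : ℝ) + 4 - 1) * (σ : ℝ) ^ ((j₁ : ℝ) + j₂ + 4 - ε / 2 - 1) =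
      (σ : ℝ) ^ (ε / 2 + 1 - 1) * (σ : ℝ) ^ (-ε - 1) * (σ : ℝ) ^ ((j₁ : ℝ) + j₂ + 3 - 1) *
        (σ : ℝ) ^ (j₁ + 5) := by
    rw [← Real.rpow_natCast]
    simp only [← Real.rpow_add hσ0]
    congr 1
    push_cast
    ring
  have hscale : ∀ P₁ P₂ P₃ Q₁ Q₂ f p₁ p₂ p₃ q₁ q₂ s : ℝ, f ≠ 0 → p₁ ≠ 0 → p₂ ≠ 0 → p₃ ≠ 0 →
      q₁ * q₂ = p₁ * p₂ * p₃ * s →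
      P₁ / (f * p₁) * (P₂ / (f * p₂)) * (P₃ / (f * p₃)) / (Q₁ / (f * q₁) * (Q₂ / (f * q₂))) =
        P₁ * P₂ * P₃ / (Q₁ * Q₂ * f) * s := by
    intro P₁ P₂ P₃ Q₁ Q₂ f p₁ p₂ p₃ q₁ q₂ s hf h₁ h₂ h₃ h
    have hden : Q₁ / (f * q₁) * (Q₂ / (f * q₂)) = Q₁ * Q₂ / (f ^ 2 * (p₁ * p₂ * p₃ * s)) := by
      rw [← h, div_mul_div_comm]
      ring
    rw [hden, div_div_eq_mul_div]
    field_simp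
  simp only [Pi.div_apply] at hbound
  rw [hscale _ _ _ _ _ _ _ _ _ _ _ _ (by positivity) (by positivity) (by positivity)
    (by positivity) hexp, Real.norm_eq_abs, abs_mul, abs_of_pos (pow_pos hσ0 (j₁ + 5))] at hbound
  have hpow : (σ : ℝ) ^ 5 ≤ (σ : ℝ) ^ (j₁ + 5) := pow_le_pow_right₀ hσ1 (by lia)
  rw [zpow_neg, ← div_eq_mul_inv, le_div_iff₀ (by positivity)]
  exact (mul_le_mul_of_nonneg_left (by exact_mod_cast hpow) (abs_nonneg _)).trans hbound
end
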